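/- Let n be a positive integer, let dim_* be one of dim_T, dim_H, dim_P, and let K be a compact metric space with d^n_*(K) > 0. Then the following are equivalent: (i) R_*(f) equals the interior of f(K) for a generic f ∈ C(K,ℝⁿ); (ii) R_*(f) is dense in the interior of f(K) for a generic f ∈ C(K,ℝⁿ); (iii) for every open set U ⊆ K, either d^n_*(U) = d^n_*(K) or dim_T U < n. -/

import Mathlib

open Set Metric Filter Topology TopologicalSpace
open scoped ENNReal NNReal

noncomputable section

universe u

/-- `indBelow n X` means that the small inductive (topological) dimension of `X`
is at most `n - 1`; in particular `indBelow 0 X` means `X = ∅`. -/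
def indBelow : ℕ → ∀ (X : Type u) [TopologicalSpace X], Prop
  | 0, X, _ => IsEmpty X
  | n + 1, X, inst =>
      letI := inst
      ∀ (x : X) (U : Set X), IsOpen U → x ∈ U →
        ∃ V : Set X, IsOpen V ∧ x ∈ V ∧ V ⊆ U ∧ indBelow n ↥(frontier V)

/-- The small inductive (topological) dimension, with values in `EReal`:
`-1` for the empty space and `⊤` if there is no finite bound. -/
def indDim (X : Type u) [TopologicalSpace X] : EReal :=
  sInf {d : EReal | ∃ n : ℕ, indBelow n X ∧ d = (n : EReal) - 1}

variable {X : Type u} [MetricSpace X]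

/-- Topological dimension of a subset of a metric space. -/
def tdim (A : Set X) : EReal := indDim ↥A

open Classical in
/-- Hausdorff dimension of a subset of a metric space,
with the convention `dim ∅ = -1`. -/
def hdim (A : Set X) : EReal := if A = ∅ then -1 else ((dimH A : ℝ≥0∞) : EReal)

/-- A `δ`-packing of `A`: a countable family of pairwise disjoint closed balls
with centers in `A` and radii at most `δ`. -/
def IsPacking (A : Set X) (δ : ℝ≥0) (s : Set (X × ℝ≥0)) : Prop :=
  s.Countable ∧ (∀ p ∈ s, p.1 ∈ A ∧ p.2 ≤ δ) ∧
    s.Pairwise fun p q => Disjoint (closedBall p.1 (p.2 : ℝ)) (closedBall q.1 (q.2 : ℝ))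

/-- The packing pre-measure `P^h_δ(A)`. -/
def packPre (h : ℝ≥0 → ℝ≥0) (A : Set X) (δ : ℝ≥0) : ℝ≥0∞ :=
  ⨆ (s : Set (X × ℝ≥0)) (_ : IsPacking A δ s), ∑' p : s, ((h p.1.2 : ℝ≥0) : ℝ≥0∞)

/-- The packing pre-measure (packing number) `P^h₀(A) = lim_{δ → 0+} P^h_δ(A)`. -/
def packPre0 (h : ℝ≥0 → ℝ≥0) (A : Set X) : ℝ≥0∞ :=
  ⨅ (δ : ℝ≥0) (_ : 0 < δ), packPre h A δ

/-- The `h`-packing measure `𝒫^h(A)`. -/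
def packMeasure (h : ℝ≥0 → ℝ≥0) (A : Set X) : ℝ≥0∞ :=
  ⨅ (c : ℕ → Set X) (_ : A = ⋃ i, c i), ∑' i, packPre0 h (c i)

open Classical in
/-- The packing dimension, with the convention `dim ∅ = -1`. -/
def pdim (A : Set X) : EReal :=
  if A = ∅ then -1
  else max 0 (⨆ (s : ℝ≥0) (_ : packMeasure (fun r => r ^ (s : ℝ)) A = ∞), ((s : ℝ) : EReal))

/-- The restriction of the packing measure `𝒫^h` to `A` is σ-finite. -/
def PackSigmaFiniteOn (h : ℝ≥0 → ℝ≥0) (A : Set X) : Prop :=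
  ∃ c : ℕ → Set X, A ⊆ ⋃ i, c i ∧ ∀ i, packMeasure h (A ∩ c i) < ∞

/-- The generalized Hausdorff measure `ℋ^h(A)` associated to a gauge function `h`. -/
def hMeasure (h : ℝ≥0 → ℝ≥0) (A : Set X) : ℝ≥0∞ :=
  ⨆ (δ : ℝ≥0) (_ : 0 < δ),
    ⨅ (c : ℕ → Set X) (_ : A ⊆ ⋃ i, c i) (_ : ∀ i, EMetric.diam (c i) ≤ (δ : ℝ≥0∞)),
      ∑' i, ((h (EMetric.diam (c i)).toNNReal : ℝ≥0) : ℝ≥0∞)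

/-- `F` is an `F_σ` subset of the subspace `A`. -/
def IsFSigmaIn (F A : Set X) : Prop :=
  ∃ C : ℕ → Set X, (∀ i, IsClosed (C i)) ∧ F = ⋃ i, C i ∩ A

/-- `d^n_*(A) = inf {dim_*(A ∖ F) : F ⊆ A is F_σ in A and dim_T F ≤ n - 1}`. -/
def dStar (dim : Set X → EReal) (n : ℕ) (A : Set X) : EReal :=
  sInf {d : EReal |
    ∃ F : Set X, IsFSigmaIn F A ∧ tdim F ≤ (n : EReal) - 1 ∧ d = dim (A \ F)}

end

universe u

/-! ### Small inductive dimension -/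

theorem indBelow.of_isEmbedding {n : ℕ} : ∀ {X Y : Type u} [TopologicalSpace X] [TopologicalSpace Y]
    {f : X → Y}, IsEmbedding f → indBelow n Y → indBelow n X := by
  induction n with
  | zero =>
    intro X Y _ _ f _ h
    have : IsEmpty Y := h
    exact (Function.isEmpty f : IsEmpty X)
  | succ n ih =>
    intro X Y _ _ f hf h x U hU hx
    obtain ⟨U', hU', rfl⟩ := hf.isInducing.isOpen_iff.1 hU
    obtain ⟨V, hV, hxV, hVU, hfr⟩ := h (f x) U' hU' hx
    have hsub : frontier (f ⁻¹' V) ⊆ f ⁻¹' frontier V := hf.continuous.frontier_preimage_subset V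
    refine ⟨f ⁻¹' V, hV.preimage hf.continuous, hxV, preimage_mono hVU, ?_⟩
    refine ih (f := fun z : frontier (f ⁻¹' V) => (⟨f z.1, hsub z.2⟩ : frontier V)) ?_ hfr
    exact IsEmbedding.of_comp (hf.continuous.comp continuous_subtype_val |>.subtype_mk _)
      continuous_subtype_val (hf.comp IsEmbedding.subtypeVal)

theorem indBelow.mono_set {X : Type u} [TopologicalSpace X] {n : ℕ} {A B : Set X} (hAB : A ⊆ B)
    (h : indBelow n B) : indBelow n A :=
  h.of_isEmbedding (IsEmbedding.inclusion hAB)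

theorem indBelow.succ {n : ℕ} : ∀ {X : Type u} [TopologicalSpace X],
    indBelow n X → indBelow (n + 1) X := by
  induction n with
  | zero =>
    intro X _ h x
    have : IsEmpty X := h
    exact isEmptyElim x
  | succ n ih =>
    intro X _ h x U hU hx
    obtain ⟨V, hV, hxV, hVU, hfr⟩ := h x U hU hx
    exact ⟨V, hV, hxV, hVU, ih hfr⟩

theorem indBelow.mono {n m : ℕ} (hnm : n ≤ m) {X : Type u} [TopologicalSpace X]
    (h : indBelow n X) : indBelow m X := by
  induction hnm with
  | refl => exact h
  | step _ ih => exact ih.succ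

theorem EReal.natCast_sub_one_eq (m : ℕ) : (m : EReal) - 1 = ((m - 1 : ℝ) : EReal) := by
  rw [EReal.coe_sub, EReal.coe_natCast, EReal.coe_one]

theorem EReal.natCast_sub_one_lt_iff {m k : ℕ} : (m : EReal) - 1 < k ↔ m ≤ k := by
  rw [EReal.natCast_sub_one_eq, ← EReal.coe_natCast, EReal.coe_lt_coe_iff, sub_lt_iff_lt_add]
  exact_mod_cast Nat.lt_succ_iff

theorem indDim_lt_iff {X : Type u} [TopologicalSpace X] {k : ℕ} :
    indDim X < (k : EReal) ↔ indBelow k X := by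
  constructor
  · intro h
    obtain ⟨d, ⟨m, hm, rfl⟩, hd⟩ := sInf_lt_iff.1 h
    exact hm.mono (EReal.natCast_sub_one_lt_iff.1 hd)
  · intro h
    exact lt_of_le_of_lt (sInf_le ⟨k, h, rfl⟩) (EReal.natCast_sub_one_lt_iff.2 le_rfl)

theorem indDim_le_iff {X : Type u} [TopologicalSpace X] {k : ℕ} :
    indDim X ≤ (k : EReal) - 1 ↔ indBelow k X := by
  constructor
  · intro h
    exact indDim_lt_iff.1 (lt_of_le_of_lt h (EReal.natCast_sub_one_lt_iff.2 le_rfl))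
  · intro h
    exact sInf_le ⟨k, h, rfl⟩

/-! ### Zero-dimensional subsets -/

/-- A space with a basis of clopen sets. -/
def HasClopenBasis (X : Type u) [TopologicalSpace X] : Prop :=
  ∀ (x : X) (U : Set X), IsOpen U → x ∈ U → ∃ V : Set X, IsClopen V ∧ x ∈ V ∧ V ⊆ U

theorem hasClopenBasis_iff {X : Type u} [TopologicalSpace X] :
    HasClopenBasis X ↔ indBelow 1 X := by
  constructor
  · intro h x U hU hx
    obtain ⟨V, hV, hxV, hVU⟩ := h x U hU hx
    refine ⟨V, hV.isOpen, hxV, hVU, ?_⟩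
    rw [hV.frontier_eq]
    exact (inferInstance : IsEmpty (∅ : Set X))
  · intro h x U hU hx
    obtain ⟨V, hV, hxV, hVU, hfr⟩ := h x U hU hx
    refine ⟨V, isClopen_iff_frontier_eq_empty.2 ?_, hxV, hVU⟩
    exact isEmpty_coe_sort.1 hfr

theorem HasClopenBasis.of_isEmbedding {X Y : Type u} [TopologicalSpace X] [TopologicalSpace Y]
    {f : X → Y} (hf : IsEmbedding f) (h : HasClopenBasis Y) : HasClopenBasis X :=
  hasClopenBasis_iff.2 ((hasClopenBasis_iff.1 h).of_isEmbedding hf)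

theorem hasClopenBasis_of_isEmpty {X : Type u} [TopologicalSpace X] [IsEmpty X] :
    HasClopenBasis X := fun x => isEmptyElim x

/-- In a second countable space with a clopen basis, a family of neighbourhoods of points can be
refined to a countable clopen partition. -/
theorem HasClopenBasis.exists_partition {X : Type u} [TopologicalSpace X]
    [SecondCountableTopology X] (h : HasClopenBasis X) (O : X → Set X)
    (hO : ∀ x, IsOpen (O x) ∧ x ∈ O x) :
    ∃ P : ℕ → Set X, (∀ j, IsClopen (P j)) ∧ Pairwise (Function.onFun Disjoint P) ∧
      ⋃ j, P j = univ ∧ ∀ j, P j = ∅ ∨ ∃ x, P j ⊆ O x := by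
  choose V hV hxV hVO using fun x => h x (O x) (hO x).1 (hO x).2
  obtain ⟨T, hT, hcov⟩ := isOpen_iUnion_countable V fun x => (hV x).isOpen
  have huniv : ⋃ x, V x = univ := eq_univ_of_forall fun x => mem_iUnion.2 ⟨x, hxV x⟩
  rw [huniv] at hcov
  rcases T.eq_empty_or_nonempty with rfl | hne
  · have : IsEmpty X := univ_eq_empty_iff.1 (hcov.symm.trans (biUnion_empty _))
    exact ⟨fun _ => ∅, fun _ => isClopen_empty, fun i j _ => by simp [Function.onFun],
      by rw [iUnion_empty]; exact (univ_eq_empty_iff.2 this).symm, fun j => Or.inl rfl⟩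
  obtain ⟨s, rfl⟩ := hT.exists_eq_range hne
  rw [biUnion_range] at hcov
  refine ⟨disjointed fun j => V (s j), fun j => ?_, disjoint_disjointed _, ?_, fun j => ?_⟩
  · exact disjointedRec (p := IsClopen) (fun _ i ht => ht.diff (hV _)) (hV _)
  · rw [iUnion_disjointed]; exact hcov
  · exact Or.inr ⟨s j, (disjointed_subset _ j).trans (hVO _)⟩

theorem HasClopenBasis.exists_separation {X : Type u} [TopologicalSpace X]
    [SecondCountableTopology X] (h : HasClopenBasis X) {E F : Set X} (hE : IsClosed E)
    (hF : IsClosed F) (hEF : Disjoint E F) : ∃ U, IsClopen U ∧ E ⊆ U ∧ Disjoint U F := by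
  classical
  obtain ⟨P, hP, hdis, hcov, hsub⟩ := h.exists_partition (fun x => if x ∈ E then Fᶜ else Eᶜ) (by
    intro x
    by_cases hx : x ∈ E
    · simp only [hx, if_true]
      exact ⟨hF.isOpen_compl, fun h => disjoint_left.1 hEF hx h⟩
    · simp only [hx, if_false]
      exact ⟨hE.isOpen_compl, hx⟩)
  have hdich : ∀ j, Disjoint (P j) E ∨ Disjoint (P j) F := by
    intro j
    rcases hsub j with h | ⟨x, hx⟩
    · left; simp [h]
    · by_cases hxE : x ∈ E
      · right; simp only [hxE, if_true] at hx; exact disjoint_left.2 fun z hz => hx hz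
      · left; simp only [hxE, if_false] at hx; exact disjoint_left.2 fun z hz => hx hz
  set U := ⋃ j ∈ {j | ¬ Disjoint (P j) E}, P j with hU
  have hcompl : Uᶜ = ⋃ j ∈ {j | Disjoint (P j) E}, P j := by
    ext x
    obtain ⟨j, hj⟩ := mem_iUnion.1 (hcov.symm ▸ mem_univ x : x ∈ ⋃ j, P j)
    have huniq : ∀ i, x ∈ P i → i = j := fun i hi => by
      by_contra hij
      exact disjoint_left.1 (hdis hij) hi hj
    simp only [hU, mem_compl_iff, mem_iUnion, mem_ofPred_eq, exists_prop, not_exists, not_and]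
    constructor
    · intro h
      exact ⟨j, by_contra fun hc => h j hc hj, hj⟩
    · rintro ⟨i, hi, hxi⟩ k hk hxk
      rw [huniq i hxi] at hi
      rw [huniq k hxk] at hk
      exact hk hi
  refine ⟨U, ⟨?_, ?_⟩, ?_, ?_⟩
  · rw [← isOpen_compl_iff, hcompl]
    exact isOpen_biUnion fun j _ => (hP j).isOpen
  · exact isOpen_biUnion fun j _ => (hP j).isOpen
  · intro x hx
    obtain ⟨j, hj⟩ := mem_iUnion.1 (hcov.symm ▸ mem_univ x : x ∈ ⋃ j, P j)
    exact mem_biUnion (show j ∈ {j | ¬ Disjoint (P j) E} from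
      fun hd => disjoint_left.1 hd hj hx) hj
  · rw [disjoint_left]
    intro x hx hxF
    obtain ⟨j, hj, hxj⟩ := mem_iUnion₂.1 hx
    exact disjoint_left.1 ((hdich j).resolve_left hj) hxj hxF

theorem exists_enlargement {X : Type u} [TopologicalSpace X] [NormalSpace X]
    [SecondCountableTopology X] {C : Set X} (hC : IsClosed C) (hz : HasClopenBasis C)
    {E F : Set X} (hE : IsClosed E) (hF : IsClosed F) (hEF : Disjoint E F) :
    ∃ E' F' : Set X, IsClosed E' ∧ IsClosed F' ∧ Disjoint E' F' ∧ E ⊆ interior E' ∧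
      F ⊆ interior F' ∧ C ⊆ E' ∪ F' := by
  obtain ⟨U, hU, hEU, hUF⟩ := hz.exists_separation (hE.preimage continuous_subtype_val)
    (hF.preimage continuous_subtype_val) (hEF.preimage _)
  have hemb := hC.isClosedEmbedding_subtypeVal
  have hE2 : IsClosed (E ∪ Subtype.val '' U) := hE.union (hemb.isClosedMap _ hU.isClosed)
  have hF2 : IsClosed (F ∪ Subtype.val '' Uᶜ) :=
    hF.union (hemb.isClosedMap _ hU.compl.isClosed)
  have hd : Disjoint (E ∪ Subtype.val '' U) (F ∪ Subtype.val '' Uᶜ) := by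
    rw [disjoint_left]
    rintro x (hx | ⟨x, hx, rfl⟩) (hx' | ⟨z, hz, hzx⟩)
    · exact disjoint_left.1 hEF hx hx'
    · subst hzx; exact hz (hEU hx)
    · exact disjoint_left.1 hUF hx hx'
    · rw [Subtype.val_injective hzx] at hz; exact hz hx
  obtain ⟨U1, hU1, hEU1, hU1F⟩ := normal_exists_closure_subset hE2 hF2.isOpen_compl
    (fun x hx hx' => disjoint_left.1 hd hx hx')
  obtain ⟨V1, hV1, hFV1, hV1U⟩ := normal_exists_closure_subset hF2
    (isClosed_closure (s := U1)).isOpen_compl (fun x hx hx' => hU1F hx' hx)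
  refine ⟨closure U1, closure V1, isClosed_closure, isClosed_closure, ?_, ?_, ?_, ?_⟩
  · exact disjoint_left.2 fun x hx hx' => hV1U hx' hx
  · exact fun x hx => mem_interior.2 ⟨U1, subset_closure, hU1, hEU1 (Or.inl hx)⟩
  · exact fun x hx => mem_interior.2 ⟨V1, subset_closure, hV1, hFV1 (Or.inl hx)⟩
  · intro x hx
    by_cases h : (⟨x, hx⟩ : C) ∈ U
    · exact Or.inl (subset_closure (hEU1 (Or.inr ⟨_, h, rfl⟩)))
    · exact Or.inr (subset_closure (hFV1 (Or.inr ⟨_, h, rfl⟩)))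

/-- The countable closed sum theorem for zero-dimensional sets. -/
theorem hasClopenBasis_of_iUnion_isClosed {X : Type u} [TopologicalSpace X] [T4Space X]
    [SecondCountableTopology X] {C : ℕ → Set X} (hC : ∀ j, IsClosed (C j))
    (hz : ∀ j, HasClopenBasis (C j)) (hcov : ⋃ j, C j = univ) : HasClopenBasis X := by
  intro x O hO hx
  let Pr := {p : Set X × Set X // IsClosed p.1 ∧ IsClosed p.2 ∧ Disjoint p.1 p.2}
  have hstep : ∀ (j : ℕ) (p : Pr), ∃ q : Pr, p.1.1 ⊆ interior q.1.1 ∧ p.1.2 ⊆ interior q.1.2 ∧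
      C j ⊆ q.1.1 ∪ q.1.2 := by
    rintro j ⟨⟨E, F⟩, hE, hF, hEF⟩
    obtain ⟨E', F', h1, h2, h3, h4, h5, h6⟩ := exists_enlargement (hC j) (hz j) hE hF hEF
    exact ⟨⟨(E', F'), h1, h2, h3⟩, h4, h5, h6⟩
  choose nxt h1 h2 h3 using hstep
  let p0 : Pr := ⟨({x}, Oᶜ), isClosed_singleton, hO.isClosed_compl,
    disjoint_singleton_left.2 fun h => h hx⟩
  let S : ℕ → Pr := fun j => Nat.rec p0 (fun j p => nxt j p) j
  have hmono1 : Monotone fun j => (S j).1.1 :=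
    monotone_nat_of_le_succ fun j => (h1 j (S j)).trans interior_subset
  have hmono2 : Monotone fun j => (S j).1.2 :=
    monotone_nat_of_le_succ fun j => (h2 j (S j)).trans interior_subset
  have hopen1 : IsOpen (⋃ j, (S j).1.1) := by
    have : ⋃ j, (S j).1.1 = ⋃ j, interior (S (j + 1)).1.1 := by
      apply Subset.antisymm
      · exact iUnion_subset fun j => (h1 j (S j)).trans (subset_iUnion_of_subset j Subset.rfl)
      · exact iUnion_subset fun j => interior_subset.trans
          (subset_iUnion (fun j => (S j).1.1) (j + 1))
    rw [this]
    exact isOpen_iUnion fun j => isOpen_interior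
  have hopen2 : IsOpen (⋃ j, (S j).1.2) := by
    have : ⋃ j, (S j).1.2 = ⋃ j, interior (S (j + 1)).1.2 := by
      apply Subset.antisymm
      · exact iUnion_subset fun j => (h2 j (S j)).trans (subset_iUnion_of_subset j Subset.rfl)
      · exact iUnion_subset fun j => interior_subset.trans
          (subset_iUnion (fun j => (S j).1.2) (j + 1))
    rw [this]
    exact isOpen_iUnion fun j => isOpen_interior
  have hdisj : ∀ z, z ∈ ⋃ j, (S j).1.1 → z ∈ ⋃ j, (S j).1.2 → False := by
    intro z hz1 hz2
    obtain ⟨i, hi⟩ := mem_iUnion.1 hz1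
    obtain ⟨j, hj⟩ := mem_iUnion.1 hz2
    exact disjoint_left.1 (S (max i j)).2.2.2 (hmono1 (le_max_left i j) hi)
      (hmono2 (le_max_right i j) hj)
  have hcompl : (⋃ j, (S j).1.1)ᶜ = ⋃ j, (S j).1.2 := by
    apply Subset.antisymm
    · intro z hz1
      obtain ⟨j, hj⟩ := mem_iUnion.1 (hcov.symm ▸ mem_univ z : z ∈ ⋃ j, C j)
      rcases h3 j (S j) hj with h | h
      · exact absurd (mem_iUnion.2 ⟨j + 1, h⟩) hz1
      · exact mem_iUnion.2 ⟨j + 1, h⟩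
    · exact fun z hz2 hz1 => hdisj z hz1 hz2
  refine ⟨⋃ j, (S j).1.1, ⟨?_, hopen1⟩, mem_iUnion.2 ⟨0, rfl⟩, fun z hz1 => ?_⟩
  · rw [← isOpen_compl_iff, hcompl]; exact hopen2
  · by_contra hzO
    exact hdisj z hz1 (mem_iUnion.2 ⟨0, hzO⟩)

/-- Any two disjoint closed sets have a partition avoiding a given zero-dimensional set. -/
theorem HasClopenBasis.exists_partition_avoiding {X : Type u} [TopologicalSpace X] [T5Space X]
    [SecondCountableTopology X] {Z : Set X} (hZ : HasClopenBasis Z) {E F : Set X}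
    (hE : IsClosed E) (hF : IsClosed F) (hEF : Disjoint E F) :
    ∃ V, IsOpen V ∧ E ⊆ V ∧ Disjoint (closure V) F ∧ Disjoint (frontier V) Z := by
  obtain ⟨U1, hU1, hEU1, hU1F⟩ := normal_exists_closure_subset hE hF.isOpen_compl
    (fun x hx hx' => disjoint_left.1 hEF hx hx')
  obtain ⟨U2, hU2, hFU2, hU2U⟩ := normal_exists_closure_subset hF
    (isClosed_closure (s := U1)).isOpen_compl (fun x hx hx' => hU1F hx' hx)
  obtain ⟨W, hW, h1W, hW2⟩ := hZ.exists_separation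
    (isClosed_closure (s := U1) |>.preimage continuous_subtype_val)
    (isClosed_closure (s := U2) |>.preimage continuous_subtype_val)
    (Disjoint.preimage _ (disjoint_left.2 fun x hx hx' => hU2U hx' hx))
  set Z1 : Set X := Subtype.val '' W
  set Z2 : Set X := Subtype.val '' Wᶜ
  have hU1c : ∀ x ∈ closure U1, x ∉ closure U2 := fun x hx hx' => hU2U hx' hx
  have hZ1U2 : Disjoint Z1 U2 := by
    rw [disjoint_left]
    rintro _ ⟨x, hx, rfl⟩ h
    exact disjoint_left.1 hW2 hx (subset_closure h)
  have hZ2U1 : Disjoint Z2 U1 := by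
    rw [disjoint_left]
    rintro _ ⟨x, hx, rfl⟩ h
    exact hx (h1W (subset_closure h))
  have hZ12 : Disjoint (closure Z1) Z2 := by
    rw [disjoint_left]
    rintro _ h ⟨x, hx, rfl⟩
    apply hx
    rw [← hW.isClosed.closure_eq, IsEmbedding.subtypeVal.closure_eq_preimage_closure_image]
    exact h
  have hZ21 : Disjoint Z1 (closure Z2) := by
    rw [disjoint_left]
    rintro _ ⟨x, hx, rfl⟩ h
    have : x ∈ closure Wᶜ := by
      rw [IsEmbedding.subtypeVal.closure_eq_preimage_closure_image]
      exact h
    rw [hW.compl.isClosed.closure_eq] at this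
    exact this hx
  have hs1 : Disjoint (closure (E ∪ Z1)) (F ∪ Z2) := by
    rw [closure_union, hE.closure_eq, disjoint_union_left, disjoint_union_right,
      disjoint_union_right]
    refine ⟨⟨hEF, ?_⟩, ?_, hZ12⟩
    · exact (hZ2U1.mono_right hEU1).symm
    · exact ((hZ1U2.closure_left hU2).mono_right hFU2)
  have hs2 : Disjoint (E ∪ Z1) (closure (F ∪ Z2)) := by
    rw [closure_union, hF.closure_eq, disjoint_union_left, disjoint_union_right,
      disjoint_union_right]
    refine ⟨⟨hEF, ?_⟩, ?_, hZ21⟩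
    · exact ((hZ2U1.closure_left hU1).mono_right hEU1).symm
    · exact hZ1U2.mono_right hFU2
  obtain ⟨V, V', hV, hV', h1, h2, hd⟩ := separatedNhds_iff_disjoint.2 (completely_normal hs1 hs2)
  have hcl : Disjoint (closure V) V' := hd.closure_left hV'
  refine ⟨V, hV, fun x hx => h1 (Or.inl hx), hcl.mono_right fun x hx => h2 (Or.inl hx), ?_⟩
  rw [disjoint_left]
  intro x hx hxZ
  by_cases hxW : (⟨x, hxZ⟩ : Z) ∈ W
  · have : x ∈ V := h1 (Or.inr ⟨_, hxW, rfl⟩)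
    rw [hV.frontier_eq] at hx
    exact hx.2 this
  · exact disjoint_left.1 hcl hx.1 (h2 (Or.inr ⟨_, hxW, rfl⟩))

/-- A zero-dimensional subset of a metric space is covered by a disjoint sequence of small open
sets. -/
theorem HasClopenBasis.exists_disjoint_cover {X : Type u} [MetricSpace X]
    [SecondCountableTopology X] {Z : Set X} (hZ : HasClopenBasis Z) {ε : ℝ} (hε : 0 < ε) :
    ∃ O : ℕ → Set X, (∀ j, IsOpen (O j)) ∧ Pairwise (Function.onFun Disjoint O) ∧
      Z ⊆ ⋃ j, O j ∧ ∀ j, ∀ x ∈ O j, ∀ y ∈ O j, dist x y ≤ ε := by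
  obtain ⟨P, hP, hdis, hcov, hsub⟩ := hZ.exists_partition
    (fun x => Subtype.val ⁻¹' ball x.1 (ε / 4)) (fun x =>
      ⟨isOpen_ball.preimage continuous_subtype_val, mem_ball_self (by positivity)⟩)
  set Q : ℕ → Set X := fun j => Subtype.val '' P j
  set Q' : ℕ → Set X := fun j => Subtype.val '' (P j)ᶜ
  have hdia : ∀ j, ∀ x ∈ Q j, ∀ y ∈ Q j, dist x y ≤ ε / 2 := by
    rintro j _ ⟨x, hx, rfl⟩ _ ⟨y, hy, rfl⟩
    rcases hsub j with h | ⟨z, hz⟩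
    · rw [h] at hx; exact hx.elim
    · have h1 : dist x.1 z.1 < ε / 4 := hz hx
      have h2 : dist y.1 z.1 < ε / 4 := hz hy
      linarith [dist_triangle_right x.1 y.1 z.1]
  have hQQ' : ∀ i j, i ≠ j → Q i ⊆ Q' j := by
    rintro i j hij _ ⟨x, hx, rfl⟩
    exact ⟨x, fun hxj => disjoint_left.1 (hdis hij) hx hxj, rfl⟩
  refine ⟨fun j => {x | infEDist x (Q j) < infEDist x (Q' j)} ∩ thickening (ε / 4) (Q j),
    fun j => ?_, ?_, ?_, ?_⟩
  · exact (isOpen_lt continuous_infEDist continuous_infEDist).inter isOpen_thickening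
  · intro i j hij
    refine disjoint_left.2 ?_
    rintro x ⟨hx1, -⟩ ⟨hx2, -⟩
    have h1 : infEDist x (Q i) < infEDist x (Q j) :=
      lt_of_lt_of_le hx1 (infEDist_anti (hQQ' j i hij.symm))
    have h2 : infEDist x (Q j) < infEDist x (Q i) :=
      lt_of_lt_of_le hx2 (infEDist_anti (hQQ' i j hij))
    exact lt_asymm h1 h2
  · intro x hx
    obtain ⟨j, hj⟩ := mem_iUnion.1 (hcov.symm ▸ mem_univ (⟨x, hx⟩ : Z) : (⟨x, hx⟩ : Z) ∈ ⋃ j, P j)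
    have hxQ : x ∈ Q j := ⟨_, hj, rfl⟩
    refine mem_iUnion.2 ⟨j, ?_, self_subset_thickening (by positivity) _ hxQ⟩
    simp only [mem_ofPred_eq]
    rw [infEDist_zero_of_mem hxQ, infEDist_pos_iff_notMem_closure]
    intro hcl
    have : (⟨x, hx⟩ : Z) ∈ closure (P j)ᶜ := by
      rw [IsEmbedding.subtypeVal.closure_eq_preimage_closure_image]
      exact hcl
    rw [(hP j).compl.isClosed.closure_eq] at this
    exact this hj
  · rintro j x ⟨-, hx⟩ y ⟨-, hy⟩
    obtain ⟨x', hx', hxx'⟩ := mem_thickening_iff.1 hx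
    obtain ⟨y', hy', hyy'⟩ := mem_thickening_iff.1 hy
    have := hdia j x' hx' y' hy'
    linarith [dist_triangle4 x x' y' y, dist_comm y y']

/-- A zero-dimensional set is contained in a zero-dimensional `G_δ` set. -/
theorem HasClopenBasis.exists_isGδ_superset {X : Type u} [MetricSpace X]
    [SecondCountableTopology X] {Z : Set X} (hZ : HasClopenBasis Z) :
    ∃ G, IsGδ G ∧ Z ⊆ G ∧ HasClopenBasis G := by
  choose O hO hdis hcov hdia using fun m : ℕ =>
    hZ.exists_disjoint_cover (Nat.one_div_pos_of_nat (α := ℝ) (n := m))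
  refine ⟨⋂ m, ⋃ j, O m j, .iInter_of_isOpen fun m => isOpen_iUnion fun j => hO m j,
    subset_iInter hcov, ?_⟩
  rintro ⟨x, hx⟩ U hU hxU
  obtain ⟨r, hr, hrU⟩ := Metric.isOpen_iff.1 hU _ hxU
  obtain ⟨m, hm⟩ := exists_nat_one_div_lt hr
  obtain ⟨j, hj⟩ := mem_iUnion.1 (mem_iInter.1 hx m)
  refine ⟨Subtype.val ⁻¹' O m j, ⟨?_, (hO m j).preimage continuous_subtype_val⟩, hj, ?_⟩
  · have : (Subtype.val ⁻¹' O m j : Set ↥(⋂ m, ⋃ j, O m j))ᶜ =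
        Subtype.val ⁻¹' ⋃ i ∈ {i | i ≠ j}, O m i := by
      ext ⟨z, hz⟩
      simp only [mem_compl_iff, mem_preimage, mem_iUnion, mem_ofPred_eq, exists_prop]
      constructor
      · intro h
        obtain ⟨i, hi⟩ := mem_iUnion.1 (mem_iInter.1 hz m)
        exact ⟨i, fun hij => h (hij ▸ hi), hi⟩
      · rintro ⟨i, hij, hi⟩ h
        exact disjoint_left.1 (hdis m hij) hi h
    rw [← isOpen_compl_iff, this]
    exact (isOpen_biUnion fun i _ => hO m i).preimage continuous_subtype_val
  · rintro ⟨z, hz⟩ hzj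
    exact hrU (lt_of_le_of_lt (hdia m j z hzj x hj) hm)

/-! ### Decomposition into zero-dimensional sets -/

/-- `A` is covered by `n` zero-dimensional sets. -/
def ZeroDimCover {X : Type u} [TopologicalSpace X] (n : ℕ) (A : Set X) : Prop :=
  ∃ Z : Fin n → Set X, A ⊆ ⋃ i, Z i ∧ ∀ i, HasClopenBasis (Z i)

theorem HasClopenBasis.image_val {X : Type u} [TopologicalSpace X] {A : Set X} {Z : Set A}
    (h : HasClopenBasis Z) : HasClopenBasis (Subtype.val '' Z : Set X) :=
  h.of_isEmbedding (IsEmbedding.subtypeVal.homeomorphImage Z).symm.isEmbedding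

theorem HasClopenBasis.preimage_val {X : Type u} [TopologicalSpace X] {A : Set X} {Z : Set X}
    (h : HasClopenBasis Z) : HasClopenBasis (Subtype.val ⁻¹' Z : Set A) := by
  have he : IsEmbedding ((Subtype.val : A → X) ∘ (Subtype.val : (Subtype.val ⁻¹' Z : Set A) → A)) :=
    IsEmbedding.subtypeVal.comp IsEmbedding.subtypeVal
  exact h.of_isEmbedding (he.codRestrict Z fun z => z.2)

theorem ZeroDimCover.mono {X : Type u} [TopologicalSpace X] {n : ℕ} {A B : Set X}
    (h : ZeroDimCover n B) (hAB : A ⊆ B) : ZeroDimCover n A := by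
  obtain ⟨Z, hZ, hc⟩ := h
  exact ⟨Z, hAB.trans hZ, hc⟩

theorem zeroDimCover_coe_univ_iff {X : Type u} [TopologicalSpace X] {n : ℕ} {A : Set X} :
    ZeroDimCover n (univ : Set A) ↔ ZeroDimCover n A := by
  constructor
  · rintro ⟨Z, hZ, hc⟩
    refine ⟨fun i => Subtype.val '' Z i, fun x hx => ?_, fun i => (hc i).image_val⟩
    obtain ⟨i, hi⟩ := mem_iUnion.1 (hZ (mem_univ (⟨x, hx⟩ : A)))
    exact mem_iUnion.2 ⟨i, _, hi, rfl⟩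
  · rintro ⟨Z, hZ, hc⟩
    refine ⟨fun i => Subtype.val ⁻¹' Z i, fun x _ => ?_, fun i => (hc i).preimage_val⟩
    obtain ⟨i, hi⟩ := mem_iUnion.1 (hZ x.2)
    exact mem_iUnion.2 ⟨i, hi⟩

theorem ZeroDimCover.iUnion_isClosed {X : Type u} [MetricSpace X] [SecondCountableTopology X]
    {n : ℕ} {A : Set X} {C : ℕ → Set X} (hC : ∀ j, IsClosed (C j)) (hA : A ⊆ ⋃ j, C j)
    (h : ∀ j, ZeroDimCover n (C j ∩ A)) : ZeroDimCover n A := by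
  choose Y hY hYc using h
  have hopen : ∀ j, IsOpen (⋃ l ∈ {l | l < j}, C l)ᶜ := fun j =>
    ((finite_lt_nat j).isClosed_biUnion fun l _ => hC l).isOpen_compl
  choose T hT hTO hTU hTm using fun j => (hopen j).exists_iUnion_isClosed
  set B : ℕ → Set X := fun j => C j ∩ (⋃ l ∈ {l | l < j}, C l)ᶜ
  have hBdis : ∀ i j x, x ∈ B i → x ∈ B j → i = j := by
    intro i j x hi hj
    by_contra hij
    rcases lt_or_gt_of_ne hij with h | h
    · exact hj.2 (mem_biUnion (show i ∈ {l | l < j} from h) hi.1)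
    · exact hi.2 (mem_biUnion (show j ∈ {l | l < i} from h) hj.1)
  have hBcov : ∀ x ∈ A, ∃ j, x ∈ B j := by
    classical
    intro x hx
    have hex := mem_iUnion.1 (hA hx)
    refine ⟨Nat.find hex, Nat.find_spec hex, fun hc => ?_⟩
    obtain ⟨l, hl, hxl⟩ := mem_iUnion₂.1 hc
    exact Nat.find_min hex hl hxl
  refine ⟨fun i => ⋃ j, Y j i ∩ B j, fun x hx => ?_, fun i => ?_⟩
  · obtain ⟨j, hj⟩ := hBcov x hx
    obtain ⟨i, hi⟩ := mem_iUnion.1 (hY j ⟨hj.1, hx⟩)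
    exact mem_iUnion.2 ⟨i, mem_iUnion.2 ⟨j, hi, hj⟩⟩
  · obtain ⟨e⟩ : Nonempty (ℕ ≃ ℕ × ℕ) := ⟨Nat.pairEquiv.symm⟩
    refine hasClopenBasis_of_iUnion_isClosed
      (C := fun k => Subtype.val ⁻¹' (C (e k).1 ∩ T (e k).1 (e k).2)) (fun k => ?_) (fun k => ?_) ?_
    · exact ((hC _).inter (hT _ _)).preimage continuous_subtype_val
    · set W : Set ↥(⋃ j, Y j i ∩ B j) := Subtype.val ⁻¹' (C (e k).1 ∩ T (e k).1 (e k).2)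
      have hW : ∀ z : W, z.1.1 ∈ Y (e k).1 i := by
        rintro ⟨⟨z, hz⟩, hz1, hz2⟩
        obtain ⟨j, hj, hjB⟩ := mem_iUnion.1 hz
        have : j = (e k).1 := hBdis j _ z hjB ⟨hz1, hTO _ _ hz2⟩
        exact (congrArg (fun l => z ∈ Y l i) this).mp hj
      have he : IsEmbedding ((Subtype.val : ↥(⋃ j, Y j i ∩ B j) → X) ∘ (Subtype.val : W → _)) :=
        IsEmbedding.subtypeVal.comp IsEmbedding.subtypeVal
      exact (hYc (e k).1 i).of_isEmbedding (he.codRestrict _ hW)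
    · refine eq_univ_of_forall ?_
      rintro ⟨z, hz⟩
      obtain ⟨j, hj, hjB⟩ := mem_iUnion.1 hz
      have h2 := hjB.2
      rw [← hTU j] at h2
      obtain ⟨l, hl⟩ := mem_iUnion.1 h2
      refine mem_iUnion.2 ⟨e.symm (j, l), ?_⟩
      simp only [mem_preimage, Equiv.apply_symm_apply]
      exact ⟨hjB.1, hl⟩

theorem ZeroDimCover.iUnion_isClosed_of_countable {X : Type u} [MetricSpace X]
    [SecondCountableTopology X] {ι : Type*} [Countable ι]
    {n : ℕ} {A : Set X} {C : ι → Set X} (hC : ∀ j, IsClosed (C j)) (hA : A ⊆ ⋃ j, C j)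
    (h : ∀ j, ZeroDimCover n (C j ∩ A)) : ZeroDimCover n A := by
  rcases isEmpty_or_nonempty ι with hι | hι
  · have : A = ∅ := by simpa using hA
    subst this
    exact ⟨fun _ => ∅, empty_subset _, fun i => hasClopenBasis_of_isEmpty⟩
  · obtain ⟨e, he⟩ := exists_surjective_nat ι
    exact iUnion_isClosed (C := fun k => C (e k)) (fun k => hC _)
      (by rw [he.iUnion_comp]; exact hA) (fun k => h _)

theorem ZeroDimCover.of_indBelow {n : ℕ} : ∀ {X : Type u} [MetricSpace X]
    [SecondCountableTopology X], indBelow n X → ZeroDimCover n (univ : Set X) := by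
  induction n with
  | zero =>
    intro X _ _ h
    have : IsEmpty X := h
    exact ⟨fun _ => ∅, fun x => isEmptyElim x, fun i => i.elim0⟩
  | succ n ih =>
    intro X _ _ h
    have hbas : IsTopologicalBasis {V : Set X | IsOpen V ∧ indBelow n (frontier V)} :=
      isTopologicalBasis_of_isOpen_of_nhds (fun V hV => hV.1) fun x U hx hU => by
        obtain ⟨V, hV, hxV, hVU, hfr⟩ := h x U hU hx
        exact ⟨V, ⟨hV, hfr⟩, hxV, hVU⟩
    obtain ⟨s, hs, hsc, hsb⟩ := hbas.exists_countable
    have := hsc.to_subtype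
    set G : Set X := ⋃ V : s, frontier V.1
    have hG : ZeroDimCover n G := by
      refine iUnion_isClosed_of_countable (C := fun V : s => frontier V.1)
        (fun V => isClosed_frontier) Subset.rfl (fun V => ?_)
      exact (zeroDimCover_coe_univ_iff.1 (ih (hs V.2).2)).mono inter_subset_left
    obtain ⟨Z, hZ, hZc⟩ := hG
    refine ⟨Fin.cons Gᶜ Z, fun x _ => ?_, fun i => ?_⟩
    · by_cases hx : x ∈ G
      · obtain ⟨i, hi⟩ := mem_iUnion.1 (hZ hx)
        exact mem_iUnion.2 ⟨i.succ, by simpa using hi⟩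
      · exact mem_iUnion.2 ⟨0, by simpa using hx⟩
    · refine Fin.cases ?_ (fun i => ?_) i
      · rw [Fin.cons_zero]
        rintro ⟨x, hx⟩ U hU hxU
        obtain ⟨O, hO, rfl⟩ := isOpen_induced_iff.1 hU
        obtain ⟨V, hV, hxV, hVO⟩ := hsb.exists_subset_of_mem_open hxU hO
        refine ⟨Subtype.val ⁻¹' V, ?_, hxV, preimage_mono hVO⟩
        rw [isClopen_iff_frontier_eq_empty, ← subset_empty_iff]
        refine (continuous_subtype_val.frontier_preimage_subset V).trans ?_
        rintro ⟨z, hz⟩ hzV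
        exact hz (mem_iUnion.2 ⟨⟨V, hV⟩, hzV⟩)
      · rw [Fin.cons_succ]; exact hZc i

theorem ZeroDimCover.indBelow {n : ℕ} : ∀ {X : Type u} [MetricSpace X]
    [SecondCountableTopology X], ZeroDimCover n (univ : Set X) → indBelow n X := by
  induction n with
  | zero =>
    rintro X _ _ ⟨Z, hZ, -⟩
    exact univ_eq_empty_iff.1 (by simpa using hZ)
  | succ n ih =>
    rintro X _ _ ⟨Z, hZ, hZc⟩ x U hU hx
    obtain ⟨V, hV, hxV, hVU, hfr⟩ := (hZc 0).exists_partition_avoiding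
      (isClosed_singleton (x := x)) hU.isClosed_compl (disjoint_singleton_left.2 fun h => h hx)
    refine ⟨V, hV, hxV rfl, fun z hz => by_contra fun h =>
      disjoint_left.1 hVU (subset_closure hz) h, ?_⟩
    refine ih (zeroDimCover_coe_univ_iff.2 ⟨fun i => Z i.succ, fun z hz => ?_, fun i => hZc _⟩)
    obtain ⟨i, hi⟩ := mem_iUnion.1 (hZ (mem_univ z))
    refine Fin.cases (fun hi => ?_) (fun i hi => ?_) i hi
    · exact absurd hi fun h => disjoint_left.1 hfr hz h
    · exact mem_iUnion.2 ⟨i, hi⟩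

/-- The decomposition theorem of dimension theory. -/
theorem zeroDimCover_iff {X : Type u} [MetricSpace X] [SecondCountableTopology X] {n : ℕ}
    {A : Set X} : ZeroDimCover n A ↔ indBelow n A :=
  zeroDimCover_coe_univ_iff.symm.trans ⟨ZeroDimCover.indBelow, ZeroDimCover.of_indBelow⟩

/-- The countable closed sum theorem of dimension theory. -/
theorem indBelow_of_subset_iUnion_isClosed {X : Type u} [MetricSpace X]
    [SecondCountableTopology X] {ι : Type*} [Countable ι] {n : ℕ} {A : Set X} {C : ι → Set X}
    (hC : ∀ j, IsClosed (C j)) (hA : A ⊆ ⋃ j, C j) (h : ∀ j, indBelow n ↥(C j ∩ A)) :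
    indBelow n A :=
  zeroDimCover_iff.1 (ZeroDimCover.iUnion_isClosed_of_countable hC hA
    fun j => zeroDimCover_iff.2 (h j))

/-- The enlargement theorem: a set is contained in a `G_δ` set of the same dimension. -/
theorem exists_isGδ_superset_indBelow {X : Type u} [MetricSpace X] [SecondCountableTopology X]
    {n : ℕ} {A : Set X} (h : indBelow n A) : ∃ G, IsGδ G ∧ A ⊆ G ∧ indBelow n G := by
  obtain ⟨Z, hZ, hZc⟩ := zeroDimCover_iff.2 h
  choose G hG hZG hGc using fun i => (hZc i).exists_isGδ_superset
  exact ⟨⋃ i, G i, .iUnion hG, hZ.trans (iUnion_mono hZG), zeroDimCover_iff.1 ⟨G, Subset.rfl, hGc⟩⟩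

/-! ### Maps avoiding a point -/

theorem isOpen_setOf_forall_ne {K Y : Type*} [TopologicalSpace K] [TopologicalSpace Y] [T1Space Y]
    {A : Set K} (hA : IsCompact A) (q : Y) : IsOpen {f : C(K, Y) | ∀ x ∈ A, f x ≠ q} :=
  ContinuousMap.isOpen_setOfPred_mapsTo hA (isOpen_compl_singleton (x := q))

theorem IsClosed.exists_zero_iff_mem {X : Type*} [MetricSpace X] {S : Set X} (hS : IsClosed S) :
    ∃ p : C(X, ℝ), (∀ x, 0 ≤ p x) ∧ ∀ x, p x = 0 ↔ x ∈ S := by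
  rcases S.eq_empty_or_nonempty with rfl | hne
  · exact ⟨ContinuousMap.const X 1, fun x => zero_le_one, fun x => by simp⟩
  · exact ⟨⟨fun x => infDist x S, continuous_infDist_pt S⟩, fun x => infDist_nonneg,
      fun x => (hS.mem_iff_infDist_zero hne).symm⟩

theorem HasClopenBasis.exists_approx_ne {X : Type u} [MetricSpace X]
    [SecondCountableTopology X] {Z : Set X} (hZ : HasClopenBasis Z) (f : C(X, ℝ)) (a : ℝ) {ε : ℝ}
    (hε : 0 < ε) : ∃ g : C(X, ℝ), (∀ x, |g x - f x| ≤ ε) ∧ ∀ x ∈ Z, g x ≠ a := by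
  obtain ⟨V, hV, hEV, hVF, hVZ⟩ := hZ.exists_partition_avoiding
    (isClosed_le (continuous_const (y := a + ε / 2)) f.continuous)
    (isClosed_le f.continuous (continuous_const (y := a - ε / 2)))
    (disjoint_left.2 fun x (h1 : a + ε / 2 ≤ f x) (h2 : f x ≤ a - ε / 2) => by linarith)
  obtain ⟨p, hp, hp0⟩ := hV.isClosed_compl.exists_zero_iff_mem
  obtain ⟨q, hq, hq0⟩ := (isClosed_closure (s := V)).exists_zero_iff_mem
  have hpos : ∀ x ∈ V, 0 < p x - q x := fun x hx => by
    have h1 := (hp x).lt_of_ne fun h => (hp0 x).1 h.symm hx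
    have h2 := (hq0 x).2 (subset_closure hx)
    linarith
  have hneg : ∀ x ∉ closure V, p x - q x < 0 := fun x hx => by
    have h1 := (hq x).lt_of_ne fun h => hx ((hq0 x).1 h.symm)
    have h2 := (hp0 x).2 (fun h => hx (subset_closure h))
    linarith
  refine ⟨⟨fun x => a + (max (f x - a - ε / 2) 0 + min (f x - a + ε / 2) 0) +
    max (-(ε / 2)) (min (ε / 2) (p x - q x)), by fun_prop⟩, fun x => ?_, fun x hx => ?_⟩
  · simp only [ContinuousMap.coe_mk]
    rw [abs_le]
    constructor <;>
    rcases max_cases (f x - a - ε / 2) 0 with ⟨h1, h1'⟩ | ⟨h1, h1'⟩ <;>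
    rcases min_cases (f x - a + ε / 2) 0 with ⟨h2, h2'⟩ | ⟨h2, h2'⟩ <;>
    rcases min_cases (ε / 2) (p x - q x) with ⟨h3, h3'⟩ | ⟨h3, h3'⟩ <;>
    rcases max_cases (-(ε / 2)) (min (ε / 2) (p x - q x)) with ⟨h4, h4'⟩ | ⟨h4, h4'⟩ <;>
    linarith
  · simp only [ContinuousMap.coe_mk]
    have hcase : x ∈ V ∨ x ∉ closure V := by
      by_contra! h
      refine disjoint_left.1 hVZ ?_ hx
      rw [hV.frontier_eq]
      exact ⟨h.2, h.1⟩
    rcases hcase with h | h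
    · have h1 : a - ε / 2 < f x := lt_of_not_ge fun h' =>
        disjoint_left.1 hVF (subset_closure h) h'
      have h2 : 0 < max (-(ε / 2)) (min (ε / 2) (p x - q x)) :=
        lt_max_of_lt_right (lt_min (by positivity) (hpos x h))
      have h3 := le_max_right (f x - a - ε / 2) 0
      have h4 : min (f x - a + ε / 2) 0 = 0 := min_eq_right (by linarith)
      intro h; linarith
    · have h1 : f x < a + ε / 2 := lt_of_not_ge fun h' => h (subset_closure (hEV h'))
      have h2 : max (-(ε / 2)) (min (ε / 2) (p x - q x)) < 0 :=
        max_lt (by linarith) (min_lt_of_right_lt (hneg x h))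
      have h3 := min_le_right (f x - a + ε / 2) 0
      have h4 : max (f x - a - ε / 2) 0 = 0 := max_eq_right (by linarith)
      intro h; linarith

/-- If `A` is covered by `n` zero-dimensional sets then maps into `ℝⁿ` can be perturbed so as to
avoid a given point on `A`. -/
theorem ZeroDimCover.dense_forall_ne {K : Type u} [MetricSpace K] [CompactSpace K] {n : ℕ}
    {A : Set K} (hA : ZeroDimCover n A) (q : Fin n → ℝ) :
    Dense {f : C(K, Fin n → ℝ) | ∀ x ∈ A, f x ≠ q} := by
  obtain ⟨Z, hAZ, hZ⟩ := hA
  refine Metric.dense_iff.2 fun f ε hε => ?_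
  choose g hg hgZ using fun i => (hZ i).exists_approx_ne
    ⟨fun x => f x i, by fun_prop⟩ (q i) (half_pos hε)
  refine ⟨⟨fun x i => g i x, by fun_prop⟩, ?_, fun x hx h => ?_⟩
  · rw [mem_ball]
    refine lt_of_le_of_lt ((ContinuousMap.dist_le (half_pos hε).le).2 fun x => ?_) (half_lt_self hε)
    exact (dist_pi_le_iff (half_pos hε).le).2 fun i => hg i x
  · obtain ⟨i, hi⟩ := mem_iUnion.1 (hAZ hx)
    exact hgZ i x hi (congrFun h i)

/-- If maps into `ℝⁿ` can be perturbed so as to avoid the origin on the compact set `A`, then the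
dimension of `A` is less than `n`. -/
theorem indBelow_of_dense_forall_ne {K : Type u} [MetricSpace K] [CompactSpace K] {n : ℕ} :
    ∀ {A : Set K}, IsClosed A → Dense {f : C(K, Fin n → ℝ) | ∀ x ∈ A, f x ≠ 0} →
      indBelow n A := by
  induction n with
  | zero =>
    intro A _ hd
    obtain ⟨f, hf⟩ := hd.nonempty
    exact ⟨fun x => hf x.1 x.2 (Subsingleton.elim _ _)⟩
  | succ n ih =>
    intro A hA hd x U hU hxU
    obtain ⟨O, hO, rfl⟩ := isOpen_induced_iff.1 hU
    obtain ⟨r, hr, hrO⟩ := Metric.isOpen_iff.1 hO x.1 hxU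
    set D := {f : C(K, Fin (n + 1) → ℝ) | ∀ x ∈ A, f x ≠ 0}
    have hD : IsOpen D := isOpen_setOf_forall_ne hA.isCompact 0
    let cons : C(K, ℝ) → C(K, Fin n → ℝ) → C(K, Fin (n + 1) → ℝ) := fun g h =>
      ⟨fun z => Fin.cons (g z) (h z), Continuous.finCons g.continuous h.continuous⟩
    have hcons : ∀ g g' h, dist (cons g h) (cons g' h) ≤ dist g g' := fun g g' h => by
      refine (ContinuousMap.dist_le dist_nonneg).2 fun z =>
        (dist_pi_le_iff dist_nonneg).2 fun i => ?_
      refine Fin.cases ?_ (fun i => ?_) i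
      · exact ContinuousMap.dist_apply_le_dist z
      · simp [cons]
    have hcont : ∀ h, Continuous fun g => cons g h := fun h =>
      (LipschitzWith.of_dist_le_mul (K := 1) fun g g' => by simpa using hcons g g' h).continuous
    set B := countableBasis C(K, Fin n → ℝ)
    have hres : Dense (⋂ W ∈ B, {g : C(K, ℝ) | ∃ h ∈ W, cons g h ∈ D}) := by
      refine dense_biInter_of_isOpen (fun W hW => ?_) (countable_countableBasis _) fun W hW => ?_
      · have : {g : C(K, ℝ) | ∃ h ∈ W, cons g h ∈ D} = ⋃ h ∈ W, (fun g => cons g h) ⁻¹' D := by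
          ext g; simp
        rw [this]
        exact isOpen_biUnion fun h _ => hD.preimage (hcont h)
      · refine Metric.dense_iff.2 fun g ε hε => ?_
        obtain ⟨h, hh⟩ := nonempty_of_mem_countableBasis hW
        obtain ⟨δ, hδ, hδW⟩ := Metric.isOpen_iff.1 (isOpen_of_mem_countableBasis hW) h hh
        obtain ⟨f, hf, hfD⟩ := Metric.dense_iff.1 hd (cons g h) (min ε δ) (lt_min hε hδ)
        rw [mem_ball] at hf
        have hfz : ∀ z i, dist (f z i) (cons g h z i) ≤ dist f (cons g h) := fun z i =>
          (dist_le_pi_dist _ _ i).trans (ContinuousMap.dist_apply_le_dist z)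
        refine ⟨⟨fun z => f z 0, by fun_prop⟩, ?_, ⟨fun z i => f z i.succ, by fun_prop⟩,
          hδW ?_, ?_⟩
        · rw [mem_ball]
          exact lt_of_le_of_lt ((ContinuousMap.dist_le dist_nonneg).2 fun z => hfz z 0)
            (hf.trans_le (min_le_left _ _))
        · rw [mem_ball]
          exact lt_of_le_of_lt ((ContinuousMap.dist_le dist_nonneg).2 fun z =>
            (dist_pi_le_iff dist_nonneg).2 fun i => hfz z i.succ) (hf.trans_le (min_le_right _ _))
        · convert hfD
          ext z i
          refine Fin.cases ?_ (fun i => ?_) i <;> simp [cons]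
    obtain ⟨g, hg, hgD⟩ := Metric.dense_iff.1 hres
      ⟨fun z => r / 2 - dist z x, by fun_prop⟩ (r / 4) (by positivity)
    have hgd : ∀ z, |g z - (r / 2 - dist z x)| < r / 4 := fun z => by
      have := lt_of_le_of_lt (ContinuousMap.dist_apply_le_dist z) hg
      rwa [Real.dist_eq] at this
    have hA0 : indBelow n ↥(A ∩ g ⁻¹' {0}) := by
      refine ih (hA.inter (isClosed_singleton.preimage g.continuous)) ?_
      refine (isBasis_countableBasis _).dense_iff.2 fun W hW _ => ?_
      obtain ⟨h, hhW, hh⟩ := mem_iInter₂.1 hgD W hW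
      refine ⟨h, hhW, fun z hz h0 => hh z hz.1 ?_⟩
      ext i
      refine Fin.cases ?_ (fun i => ?_) i
      · simpa [cons] using hz.2
      · simp [cons, h0]
    refine ⟨{z | 0 < g z}, isOpen_lt continuous_const (by fun_prop), ?_, fun z hz => hrO ?_, ?_⟩
    · have := (abs_lt.1 (hgd x)).1
      rw [dist_self] at this
      show 0 < g x
      linarith
    · have h1 := (abs_lt.1 (hgd z)).2
      have h2 : 0 < g z := hz
      rw [mem_ball]; linarith
    · set F := frontier {z : A | 0 < g z}
      have hF : ∀ z : F, z.1.1 ∈ A ∩ g ⁻¹' {0} := fun z =>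
        ⟨z.1.2, (frontier_lt_subset_eq continuous_const (by fun_prop) z.2).symm⟩
      have he : IsEmbedding ((Subtype.val : A → K) ∘ (Subtype.val : F → A)) :=
        IsEmbedding.subtypeVal.comp IsEmbedding.subtypeVal
      exact hA0.of_isEmbedding (he.codRestrict _ hF)

/-! ### General tools -/

theorem Finset.exists_pos_forall_le {ι : Type*} (s : Finset ι) {φ : ι → ℝ}
    (h : ∀ i ∈ s, 0 < φ i) : ∃ τ > 0, ∀ i ∈ s, τ ≤ φ i := by
  classical
  induction s using Finset.induction_on with
  | empty => exact ⟨1, one_pos, by simp⟩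
  | insert a s ha ih =>
    obtain ⟨τ, hτ, hs⟩ := ih fun i hi => h i (Finset.mem_insert_of_mem hi)
    refine ⟨min τ (φ a), lt_min hτ (h a (Finset.mem_insert_self _ _)), fun i hi => ?_⟩
    rcases Finset.mem_insert.1 hi with rfl | hi
    · exact min_le_right _ _
    · exact (min_le_left _ _).trans (hs i hi)

/-- Real numbers can be chosen in prescribed intervals so as to avoid finitely many symmetric
conditions, each of which excludes finitely many values. -/
theorem exists_mem_Ioo_avoiding {ι : Type*} (s : Finset ι) {lo hi : ι → ℝ}
    (hlt : ∀ i, lo i < hi i) {Bad : ι → ι → ℝ → ℝ → Prop}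
    (hsymm : ∀ i j a b, Bad i j a b → Bad j i b a)
    (hfin : ∀ i j b, i ≠ j → {a | Bad i j a b}.Finite) :
    ∃ R : ι → ℝ, (∀ i ∈ s, R i ∈ Ioo (lo i) (hi i)) ∧
      ∀ i ∈ s, ∀ j ∈ s, i ≠ j → ¬ Bad i j (R i) (R j) := by
  classical
  induction s using Finset.induction_on with
  | empty => exact ⟨lo, by simp, by simp⟩
  | insert a s ha ih =>
    obtain ⟨R, hR, hbad⟩ := ih
    have hne : ∀ i ∈ s, i ≠ a := fun i hi h => ha (h ▸ hi)
    have hf : (⋃ j ∈ s, {r | Bad a j r (R j)}).Finite :=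
      s.finite_toSet.biUnion fun j hj => hfin a j _ (hne j hj).symm
    obtain ⟨r, hr, hrb⟩ := ((Ioo_infinite (hlt a)).sdiff hf).nonempty
    have hrb' : ∀ j ∈ s, ¬ Bad a j r (R j) := fun j hj h =>
      hrb (mem_biUnion (show j ∈ (s : Set ι) from hj) h)
    have hu : ∀ i ∈ s, Function.update R a r i = R i := fun i hi =>
      Function.update_of_ne (hne i hi) _ _
    refine ⟨Function.update R a r, fun i hi => ?_, fun i hi j hj hij => ?_⟩
    · rcases Finset.mem_insert.1 hi with rfl | hi
      · rwa [Function.update_self]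
      · rw [hu i hi]; exact hR i hi
    · rcases Finset.mem_insert.1 hi with hia | his <;> rcases Finset.mem_insert.1 hj with hja | hjs
      · exact absurd (hia.trans hja.symm) hij
      · subst hia
        rw [Function.update_self, hu j hjs]; exact hrb' j hjs
      · subst hja
        rw [Function.update_self, hu i his]
        exact fun h => hrb' i his (hsymm _ _ _ _ h)
      · rw [hu i his, hu j hjs]; exact hbad i his j hjs hij

/-- Gluing of a map with other maps near disjoint closed sets. -/
theorem exists_glue {K ι E : Type*} [TopologicalSpace K] [NormalSpace K] [NormedAddCommGroup E]
    [NormedSpace ℝ E] (s : Finset ι) {V C : ι → Set K} (hV : ∀ i ∈ s, IsOpen (V i))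
    (hC : ∀ i ∈ s, IsClosed (C i)) (hCV : ∀ i ∈ s, C i ⊆ V i)
    (hdis : ∀ i ∈ s, ∀ j ∈ s, i ≠ j → Disjoint (V i) (V j)) (f : C(K, E)) (u : ι → C(K, E)) :
    ∃ g : C(K, E), (∀ i ∈ s, ∀ x ∈ C i, g x = u i x) ∧
      (∀ i ∈ s, ∀ x ∈ V i, g x ∈ segment ℝ (f x) (u i x)) ∧
      ∀ x, (∀ i ∈ s, x ∉ V i) → g x = f x := by
  classical
  have hφ : ∀ i, ∃ φ : C(K, ℝ), i ∈ s → EqOn φ 0 (V i)ᶜ ∧ EqOn φ 1 (C i) ∧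
      ∀ x, φ x ∈ Icc (0 : ℝ) 1 := fun i => by
    by_cases hi : i ∈ s
    · obtain ⟨φ, h⟩ := exists_continuous_zero_one_of_isClosed (hV i hi).isClosed_compl (hC i hi)
        (disjoint_left.2 fun x hx hx' => hx (hCV i hi hx'))
      exact ⟨φ, fun _ => h⟩
    · exact ⟨0, fun h => absurd h hi⟩
  choose φ hφ using hφ
  have hval : ∀ i ∈ s, ∀ x ∈ V i,
      f x + ∑ j ∈ s, φ j x • (u j x - f x) = f x + φ i x • (u i x - f x) := fun i hi x hx => by
    rw [Finset.sum_eq_single_of_mem i hi]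
    intro j hj hji
    rw [(hφ j hj).1 (disjoint_left.1 (hdis i hi j hj hji.symm) hx)]
    simp
  refine ⟨⟨fun x => f x + ∑ i ∈ s, φ i x • (u i x - f x), by fun_prop⟩, fun i hi x hx => ?_,
    fun i hi x hx => ?_, fun x hx => ?_⟩
  · refine (hval i hi x (hCV i hi hx)).trans ?_
    rw [(hφ i hi).2.1 hx]
    simp
  · show f x + ∑ i ∈ s, φ i x • (u i x - f x) ∈ _
    rw [hval i hi x hx]
    refine ⟨1 - φ i x, φ i x, sub_nonneg.2 ((hφ i hi).2.2 x).2, ((hφ i hi).2.2 x).1, by ring, ?_⟩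
    rw [sub_smul, smul_sub, one_smul]
    abel
  · show f x + ∑ i ∈ s, φ i x • (u i x - f x) = f x
    rw [Finset.sum_eq_zero, add_zero]
    intro i hi
    rw [(hφ i hi).1 (hx i hi)]
    simp

theorem eventually_residual_of_approx {Y : Type*} [PseudoMetricSpace Y] {P : Y → Prop}
    (h : ∀ f, ∀ η > 0, ∃ g, dist g f ≤ η ∧ ∃ τ > 0, ∀ k, dist k g < τ → P k) :
    ∀ᶠ f in residual Y, P f := by
  have hd : Dense (interior {f | P f}) := Metric.dense_iff.2 fun f r hr => by
    obtain ⟨g, hg, τ, hτ, hP⟩ := h f (r / 2) (half_pos hr)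
    refine ⟨g, hg.trans_lt (half_lt_self hr), mem_interior_iff_mem_nhds.2 ?_⟩
    exact mem_of_superset (ball_mem_nhds g hτ) hP
  exact mem_of_superset (residual_of_dense_open isOpen_interior hd) interior_subset

theorem encard_le_of_forall_small_cover {K : Type*} [MetricSpace K] {n : ℕ} {T : Set K}
    (h : ∀ η > 0, ∃ S : Fin n → Set K, T ⊆ ⋃ k, S k ∧
      ∀ k, ∀ x ∈ S k, ∀ x' ∈ S k, dist x x' ≤ η) : T.encard ≤ n := by
  classical
  by_contra! hlt
  obtain ⟨P, hPT, hP⟩ := exists_subset_encard_eq (Order.add_one_le_of_lt hlt)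
  have hPf : P.Finite := finite_of_encard_eq_coe (k := n + 1) (by simpa using hP)
  lift P to Finset K using hPf
  have hcard : P.card = n + 1 := by
    rw [encard_coe_eq_coe_finsetCard] at hP
    exact_mod_cast hP
  obtain ⟨τ, hτ, hmin⟩ := P.offDiag.exists_pos_forall_le (φ := fun p => dist p.1 p.2)
    fun p hp => dist_pos.2 (Finset.mem_offDiag.1 hp).2.2
  obtain ⟨S, hS, hd⟩ := h (τ / 2) (half_pos hτ)
  have hex : ∀ x : P, ∃ k, x.1 ∈ S k := fun x => mem_iUnion.1 (hS (hPT x.2))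
  choose κ hκ using hex
  obtain ⟨x, x', hne, he⟩ := Fintype.exists_ne_map_eq_of_card_lt κ (by simp [hcard])
  have h1 := hd (κ x) x.1 (hκ x) x'.1 (he ▸ hκ x')
  have h2 := hmin (x.1, x'.1) (Finset.mem_offDiag.2 ⟨x.2, x'.2, fun h => hne (Subtype.ext h)⟩)
  simp only at h2
  linarith

theorem eventually_residual_encard_le {K Y : Type*} [MetricSpace K] [PseudoMetricSpace Y]
    {ι : Type*} {n : ℕ} {T : Y → ι → Set K}
    (h : ∀ η > 0, ∀ᶠ f in residual Y, ∀ y, ∃ S : Fin n → Set K, T f y ⊆ ⋃ k, S k ∧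
      ∀ k, ∀ x ∈ S k, ∀ x' ∈ S k, dist x x' ≤ η) :
    ∀ᶠ f in residual Y, ∀ y, (T f y).encard ≤ n := by
  have := eventually_countable_forall.2 fun m : ℕ => h (1 / (m + 1 : ℝ)) Nat.one_div_pos_of_nat
  filter_upwards [this] with f hf y
  refine encard_le_of_forall_small_cover fun η hη => ?_
  obtain ⟨m, hm⟩ := exists_nat_one_div_lt hη
  obtain ⟨S, hS, hd⟩ := hf m y
  exact ⟨S, hS, fun k x hx x' hx' => (hd k x hx x' hx').trans hm.le⟩

/-! ### Finiteness of generic fibers -/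

/-- Generically, the fibers of maps into `ℝⁿ` meet a compact set of dimension less than `n` in at
most `n` points. -/
theorem ZeroDimCover.eventually_encard_fiber_le {K : Type u} [MetricSpace K] [CompactSpace K]
    {n : ℕ} {A : Set K} (hA : IsClosed A) (h : ZeroDimCover n A) :
    ∀ᶠ f : C(K, Fin n → ℝ) in residual C(K, Fin n → ℝ), ∀ y, (⇑f ⁻¹' {y} ∩ A).encard ≤ n := by
  classical
  refine eventually_residual_encard_le fun η hη => eventually_residual_of_approx fun f ε hε => ?_
  obtain ⟨Z, hAZ, hZ⟩ := h
  obtain ⟨δ, hδ, hfδ⟩ := Metric.uniformContinuous_iff.1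
    (CompactSpace.uniformContinuous_of_continuous f.continuous) (ε / 2) (half_pos hε)
  have hδ' : 0 < min (δ / 2) η := lt_min (half_pos hδ) hη
  choose O hO hOd hOc hOs using fun i => (hZ i).exists_disjoint_cover hδ'
  obtain ⟨t, ht⟩ := hA.isCompact.elim_finite_subcover (fun p : Fin n × ℕ => O p.1 p.2)
    (fun p => hO _ _) fun x hx => by
      obtain ⟨i, hi⟩ := mem_iUnion.1 (hAZ hx)
      obtain ⟨j, hj⟩ := mem_iUnion.1 (hOc i hi)
      exact mem_iUnion.2 ⟨(i, j), hj⟩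
  obtain ⟨P, hP, hPO, hAP⟩ := hA.isCompact.finite_compact_cover t _ (fun p _ => hO p.1 p.2) ht
  have hb : ∀ p : Fin n × ℕ, ∃ b : ℝ, ∀ x ∈ O p.1 p.2, |f x p.1 - b| ≤ ε / 2 := fun p => by
    rcases (O p.1 p.2).eq_empty_or_nonempty with he | ⟨x₀, hx₀⟩
    · exact ⟨0, by simp [he]⟩
    · refine ⟨f x₀ p.1, fun x hx => ?_⟩
      have h1 : dist x x₀ < δ := by
        have := (hOs _ _ x hx x₀ hx₀).trans (min_le_left _ _)
        linarith
      exact (dist_le_pi_dist (f x) (f x₀) p.1).trans (hfδ h1).le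
  choose b hb using hb
  obtain ⟨a, ha, hane⟩ := exists_mem_Ioo_avoiding t (lo := fun p => b p - ε / 2)
    (hi := fun p => b p + ε / 2) (fun p => by linarith) (Bad := fun _ _ r s => r = s)
    (fun _ _ _ _ h => h.symm) (fun _ _ r _ => by simp)
  have hg : ∀ i, ∃ g : C(K, ℝ), (∀ x, |g x - f x i| ≤ ε) ∧
      ∀ j, (i, j) ∈ t → ∀ x ∈ P (i, j), g x = a (i, j) := fun i => by
    obtain ⟨g, h1, h2, h3⟩ := exists_glue (t.filter fun p => p.1 = i)
      (V := fun p => O p.1 p.2) (C := P)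
      (fun p _ => hO _ _) (fun p _ => (hP p).isClosed) (fun p _ => hPO p) (by
        rintro ⟨k, j⟩ h ⟨k', j'⟩ h' hne
        have e1 : k = i := (Finset.mem_filter.1 h).2
        have e2 : k' = i := (Finset.mem_filter.1 h').2
        subst e1; subst e2
        exact hOd k' fun h => hne (congrArg (Prod.mk k') h)) ⟨fun x => f x i, by fun_prop⟩
      (fun p => ContinuousMap.const K (a p))
    refine ⟨g, fun x => ?_, fun j hj x hx => h1 (i, j) (Finset.mem_filter.2 ⟨hj, rfl⟩) x hx⟩
    by_cases hx : ∃ p ∈ t.filter fun p => p.1 = i, x ∈ O p.1 p.2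
    · obtain ⟨p, hp, hxp⟩ := hx
      have hp' := Finset.mem_filter.1 hp
      have h4 := hb p x hxp
      rw [hp'.2] at h4
      have h5 := ha p hp'.1
      have h6 : g x ∈ closedBall (f x i) ε := by
        refine (convex_closedBall (f x i) ε).segment_subset (mem_closedBall_self hε.le) ?_
          (h2 p hp x hxp)
        rw [mem_closedBall, Real.dist_eq, ContinuousMap.const_apply, abs_le]
        rw [abs_le] at h4
        constructor <;> linarith [h5.1, h5.2, h4.1, h4.2]
      exact h6
    · push Not at hx
      rw [h3 x hx]
      simpa using hε.le
  choose g hgf hgP using hg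
  obtain ⟨τ, hτ, hmin⟩ := t.offDiag.exists_pos_forall_le (φ := fun p => |a p.1 - a p.2|)
    fun p hp => by
      obtain ⟨h1, h2, h3⟩ := Finset.mem_offDiag.1 hp
      exact abs_pos.2 (sub_ne_zero.2 (hane _ h1 _ h2 h3))
  refine ⟨⟨fun x i => g i x, by fun_prop⟩, (ContinuousMap.dist_le hε.le).2 fun x =>
    (dist_pi_le_iff hε.le).2 fun i => hgf i x, τ / 2, half_pos hτ, fun k hk y =>
    ⟨fun i => ⋃ j ∈ {j | (i, j) ∈ t ∧ |y i - a (i, j)| < τ / 2}, P (i, j), ?_, ?_⟩⟩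
  · rintro x ⟨hxy, hxA⟩
    rw [hAP] at hxA
    obtain ⟨⟨i, j⟩, hp, hx⟩ := mem_iUnion₂.1 hxA
    refine mem_iUnion.2 ⟨i, mem_biUnion (show j ∈ {j | _} from ⟨hp, ?_⟩) hx⟩
    rw [← hgP i j hp x hx, ← show k x = y from hxy]
    have hd := lt_of_le_of_lt (ContinuousMap.dist_apply_le_dist x) hk
    exact lt_of_le_of_lt (dist_le_pi_dist (k x) (fun i => g i x) i) hd
  · intro i x hx x' hx'
    obtain ⟨j, ⟨hj, hja⟩, hx⟩ := mem_iUnion₂.1 hx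
    obtain ⟨j', ⟨hj', hja'⟩, hx'⟩ := mem_iUnion₂.1 hx'
    have : j = j' := by
      by_contra hne
      have h1 := hmin ((i, j), (i, j')) (Finset.mem_offDiag.2 ⟨hj, hj', fun h => hne (by
        simpa using h)⟩)
      have h2 := abs_sub_le (a (i, j)) (y i) (a (i, j'))
      rw [abs_sub_comm (a (i, j)) (y i)] at h2
      simp only at h1
      linarith
    subst this
    exact (hOs _ _ x (hPO _ hx) x' (hPO _ hx')).trans (min_le_right _ _)

/-! ### Gadgets -/

/-- An open set `U` has a gadget for the property `Q` if some map `t` of a compact subset of `U`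
to the unit cube has the following property: if `h` is `τ`-close to a copy of `t`, scaled to radius
`R` and centered at `c`, then `Q h y` holds for all points `y` of the cube of radius `R - τ`. -/
def HasGadget {K : Type*} [TopologicalSpace K] {n : ℕ} (Q : C(K, Fin n → ℝ) → (Fin n → ℝ) → Prop)
    (U : Set K) : Prop :=
  ∃ C ⊆ U, IsClosed C ∧ ∃ t : C(K, Fin n → ℝ), (∀ x, ‖t x‖ ≤ 1) ∧
    ∀ (h : C(K, Fin n → ℝ)) (y c : Fin n → ℝ) (R τ : ℝ), 0 ≤ τ → 0 < R →
      (∀ x ∈ C, ‖h x - (c + R • t x)‖ ≤ τ) → ‖y - c‖ < R - τ → Q h y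

theorem HasGadget.mono {K : Type*} [TopologicalSpace K] {n : ℕ}
    {Q Q' : C(K, Fin n → ℝ) → (Fin n → ℝ) → Prop} {U U' : Set K} (h : HasGadget Q U)
    (hU : U ⊆ U') (hQ : ∀ f y, Q f y → Q' f y) : HasGadget Q' U' := by
  obtain ⟨C, hCU, hC, t, ht, H⟩ := h
  exact ⟨C, hCU.trans hU, hC, t, ht, fun h y c R τ h1 h2 h3 h4 => hQ _ _ (H h y c R τ h1 h2 h3 h4)⟩

theorem abs_max_min_le {r : ℝ} (hr : 0 ≤ r) (a : ℝ) : |max (-r) (min r a)| ≤ r :=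
  abs_le.2 ⟨le_max_left _ _, max_le (by linarith) (min_le_left _ _)⟩

theorem max_min_eq_self {r a : ℝ} (h : |a| ≤ r) : max (-r) (min r a) = a := by
  rw [abs_le] at h
  rw [min_eq_right h.2, max_eq_right h.1]

theorem max_min_eq_iff {r a b : ℝ} (h : |b| < r) : max (-r) (min r a) = b ↔ a = b := by
  rw [abs_lt] at h
  constructor
  · rintro rfl
    rcases min_cases r a with ⟨h1, h2⟩ | ⟨h1, h2⟩ <;>
    rcases max_cases (-r) (min r a) with ⟨h3, h4⟩ | ⟨h3, h4⟩ <;> linarith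
  · rintro rfl
    rw [min_eq_right h.2.le, max_eq_right h.1.le]

/-- A property of the zero set of a map which is stable under perturbation yields a gadget. -/
theorem hasGadget_of_forall_dist_lt {K : Type*} [TopologicalSpace K] [CompactSpace K] {n : ℕ}
    {U C : Set K} (hCU : C ⊆ U) (hC : IsClosed C) (f₀ : C(K, Fin n → ℝ)) {δ : ℝ} (hδ : 0 < δ)
    {S : Set K → Prop} (hS : ∀ g : C(K, Fin n → ℝ), dist g f₀ < δ → S (g ⁻¹' {0} ∩ C)) :
    HasGadget (fun (h : C(K, Fin n → ℝ)) y => S (h ⁻¹' {y} ∩ C)) U := by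
  refine ⟨C, hCU, hC, ⟨fun x k => max (-1) (min 1 (f₀ x k / δ)), by fun_prop⟩, fun x => ?_, ?_⟩
  · exact (pi_norm_le_iff_of_nonneg zero_le_one).2 fun k => abs_max_min_le zero_le_one _
  intro h y c R τ hτ hR hC y_mem
  simp only [ContinuousMap.coe_mk] at hC
  let e : K → Fin n → ℝ := fun x k =>
    max (-τ) (min τ (h x k - (c k + R * max (-1) (min 1 (f₀ x k / δ)))))
  have he : Continuous e := by fun_prop
  have heτ : ∀ x k, |e x k| ≤ τ := fun x k => abs_max_min_le hτ _
  have hyk : ∀ k, |y k - c k| ≤ ‖y - c‖ := fun k => norm_le_pi_norm (y - c) k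
  let g : C(K, Fin n → ℝ) := ⟨fun x k => f₀ x k + δ / R * (e x k - (y k - c k)), by fun_prop⟩
  have hg : dist g f₀ < δ := by
    have h0 : 0 ≤ δ / R * (τ + ‖y - c‖) := by positivity
    have h1 : dist g f₀ ≤ δ / R * (τ + ‖y - c‖) := by
      refine (ContinuousMap.dist_le h0).2 fun x => (dist_pi_le_iff h0).2 fun k => ?_
      rw [Real.dist_eq, show g x k - f₀ x k = δ / R * (e x k - (y k - c k)) from
        add_sub_cancel_left _ _, abs_mul, abs_of_pos (div_pos hδ hR)]
      gcongr
      exact (abs_sub _ _).trans (add_le_add (heτ x k) (hyk k))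
    refine h1.trans_lt ?_
    rw [div_mul_eq_mul_div, div_lt_iff₀ hR]
    gcongr
    linarith
  convert hS g hg using 1
  ext x
  simp only [mem_inter_iff, mem_preimage, mem_singleton_iff, and_congr_left_iff]
  intro hx
  rw [funext_iff, funext_iff]
  refine forall_congr' fun k => ?_
  have h1 : |h x k - (c k + R * max (-1) (min 1 (f₀ x k / δ)))| ≤ τ :=
    (norm_le_pi_norm _ k).trans (hC x hx)
  have h2 : e x k = h x k - (c k + R * max (-1) (min 1 (f₀ x k / δ))) := max_min_eq_self h1
  have h3 : |(y k - c k - e x k) / R| < 1 := by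
    rw [abs_div, abs_of_pos hR, div_lt_one hR]
    refine (abs_sub _ _).trans_lt ?_
    have := heτ x k
    have := hyk k
    linarith
  have h4 : g x k = 0 ↔ f₀ x k / δ = (y k - c k - e x k) / R := by
    show f₀ x k + δ / R * (e x k - (y k - c k)) = 0 ↔ _
    rw [div_eq_div_iff hδ.ne' hR.ne', div_mul_eq_mul_div, add_div' _ _ _ hR.ne', div_eq_zero_iff,
      or_iff_left hR.ne']
    constructor <;> intro h <;> linarith
  have h5 : (g x) k = (0 : Fin n → ℝ) k ↔ g x k = 0 := Iff.rfl
  rw [h5, h4, ← max_min_eq_iff h3, eq_div_iff hR.ne']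
  constructor
  · intro h; rw [h2]; linarith
  · intro h; rw [h2] at h; linarith

/-- An open set whose dimension is at least `n` contains a compact set on which some map has a
stable zero. -/
theorem exists_stable_zero {K : Type u} [MetricSpace K] [CompactSpace K] {n : ℕ} {U : Set K}
    (hU : IsOpen U) (hn : ¬ indBelow n U) : ∃ C ⊆ U, IsClosed C ∧
      ∃ f₀ : C(K, Fin n → ℝ), ∃ δ > 0, ∀ g : C(K, Fin n → ℝ), dist g f₀ < δ →
        (g ⁻¹' {0} ∩ C).Nonempty := by
  obtain ⟨C, hC, hCU, hCe, -⟩ := hU.exists_iUnion_isClosed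
  have : ∃ j, ¬ indBelow n ↥(C j) := by
    by_contra! h
    exact hn (indBelow_of_subset_iUnion_isClosed hC hCe.ge fun j =>
      (h j).mono_set inter_subset_left)
  obtain ⟨j, hj⟩ := this
  refine ⟨C j, hCU j, hC j, ?_⟩
  have hnd : ¬ Dense {f : C(K, Fin n → ℝ) | ∀ x ∈ C j, f x ≠ 0} :=
    fun h => hj (indBelow_of_dense_forall_ne (hC j) h)
  rw [Metric.dense_iff] at hnd
  push Not at hnd
  obtain ⟨f₀, δ, hδ, h⟩ := hnd
  refine ⟨f₀, δ, hδ, fun g hg => ?_⟩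
  by_contra h'
  refine (Set.eq_empty_iff_forall_notMem.1 h) g ⟨hg, fun x hx h0 => h' ⟨x, h0, hx⟩⟩

theorem exists_sign_abs_eq (a : ℝ) : ∃ σ ∈ ({1, -1} : Finset ℝ), a = σ * |a| := by
  rcases le_total 0 a with h | h
  · exact ⟨1, by simp, by rw [abs_of_nonneg h, one_mul]⟩
  · exact ⟨-1, by simp, by rw [abs_of_nonpos h]; ring⟩

theorem mul_self_of_mem_signs {σ : ℝ} (h : σ ∈ ({1, -1} : Finset ℝ)) : σ * σ = 1 := by
  simp only [Finset.mem_insert, Finset.mem_singleton] at h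
  rcases h with rfl | rfl <;> norm_num

theorem abs_of_mem_signs {σ : ℝ} (h : σ ∈ ({1, -1} : Finset ℝ)) : |σ| = 1 := by
  simp only [Finset.mem_insert, Finset.mem_singleton] at h
  rcases h with rfl | rfl <;> norm_num

/-- Radii of cubes in general position. -/
theorem exists_radii {n : ℕ} (t : Finset (Fin n → ℝ)) {η : ℝ} (hη : 0 < η) :
    ∃ R : (Fin n → ℝ) → ℝ, (∀ c ∈ t, R c ∈ Ioo (2 * η) (3 * η)) ∧ ∃ τ > 0, 4 * τ ≤ η ∧
      ∀ k, ∀ c ∈ t, ∀ c' ∈ t, ∀ σ ∈ ({1, -1} : Finset ℝ), ∀ σ' ∈ ({1, -1} : Finset ℝ),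
        |(c k + σ * R c) - (c' k + σ' * R c')| ≤ 10 * τ → c = c' ∧ σ = σ' := by
  classical
  obtain ⟨R, hR, hne⟩ := exists_mem_Ioo_avoiding t (lo := fun _ => 2 * η) (hi := fun _ => 3 * η)
    (fun _ => by linarith) (Bad := fun c c' r r' => ∃ k, ∃ σ ∈ ({1, -1} : Finset ℝ),
      ∃ σ' ∈ ({1, -1} : Finset ℝ), c k + σ * r = c' k + σ' * r')
    (fun c c' r r' ⟨k, σ, hσ, σ', hσ', h⟩ => ⟨k, σ', hσ', σ, hσ, h.symm⟩)
    (fun c c' r' _ => by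
      refine ((Finset.univ ×ˢ ({1, -1} : Finset ℝ) ×ˢ ({1, -1} : Finset ℝ) :
        Finset (Fin n × ℝ × ℝ)).image
          fun p => p.2.1 * (c' p.1 + p.2.2 * r' - c p.1)).finite_toSet.subset ?_
      rintro r ⟨k, σ, hσ, σ', hσ', h⟩
      refine Finset.mem_coe.2 (Finset.mem_image.2 ⟨(k, σ, σ'), ?_, ?_⟩)
      · exact Finset.mem_product.2 ⟨Finset.mem_univ _, Finset.mem_product.2 ⟨hσ, hσ'⟩⟩
      · simp only
        rw [← h, add_sub_cancel_left, ← mul_assoc, mul_self_of_mem_signs hσ, one_mul])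
  set J := t ×ˢ ({1, -1} : Finset ℝ)
  obtain ⟨τ, hτ, hmin⟩ := (Finset.univ ×ˢ J.offDiag :
      Finset (Fin n × ((Fin n → ℝ) × ℝ) × (Fin n → ℝ) × ℝ)).exists_pos_forall_le
    (φ := fun p => |(p.2.1.1 p.1 + p.2.1.2 * R p.2.1.1) - (p.2.2.1 p.1 + p.2.2.2 * R p.2.2.1)|) (by
      rintro ⟨k, ⟨c, σ⟩, c', σ'⟩ hp
      obtain ⟨h1, h2, h3⟩ := Finset.mem_offDiag.1 (Finset.mem_product.1 hp).2
      obtain ⟨hc, hσ⟩ := Finset.mem_product.1 h1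
      obtain ⟨hc', hσ'⟩ := Finset.mem_product.1 h2
      refine abs_pos.2 (sub_ne_zero.2 fun h => ?_)
      by_cases hcc : c = c'
      · subst hcc
        have h4 : σ * R c = σ' * R c := add_left_cancel h
        have h5 : R c ≠ 0 := (lt_trans (by positivity) (hR c hc).1).ne'
        exact h3 (by rw [mul_right_cancel₀ h5 h4])
      · exact hne c hc c' hc' hcc ⟨k, σ, hσ, σ', hσ', h⟩)
  refine ⟨R, hR, min (τ / 12) (η / 4), by positivity, ?_, ?_⟩
  · linarith [min_le_right (τ / 12) (η / 4)]
  · intro k c hc c' hc' σ hσ σ' hσ' h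
    have h1 := min_le_left (τ / 12) (η / 4)
    by_contra hcon
    have h2 := hmin (k, (c, σ), c', σ') (Finset.mem_product.2 ⟨Finset.mem_univ _,
      Finset.mem_offDiag.2 ⟨Finset.mem_product.2 ⟨hc, hσ⟩, Finset.mem_product.2 ⟨hc', hσ'⟩,
        fun h => hcon (by simpa using h)⟩⟩)
    simp only at h2
    linarith

theorem HasGadget.exists_approx {K : Type u} [MetricSpace K] [CompactSpace K] {n : ℕ}
    {Q : C(K, Fin n → ℝ) → (Fin n → ℝ) → Prop} {V L : Set K} (hV : IsOpen V)
    (hQ : ∀ U ⊆ V, IsOpen U → (U ∩ L).Nonempty → HasGadget Q U) {η : ℝ} (hη : 0 < η)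
    (f : C(K, Fin n → ℝ)) :
    ∃ g, dist g f ≤ 4 * η ∧ ∃ τ > 0, ∀ h, dist h g < τ → ∀ y, ¬ Q h y →
      (∃ z, dist z y ≤ η ∧ ∃ ρ > 0, ∀ q, dist q z < ρ → ∀ x ∈ V ∩ L, h x ≠ q) ∧
      ∃ S : Fin n → Set K, h ⁻¹' {y} ∩ (V ∩ L) ⊆ ⋃ k, S k ∧
        ∀ k, ∀ x ∈ S k, ∀ x' ∈ S k, dist x x' ≤ η := by
  classical
  rcases isEmpty_or_nonempty K with hK | hK
  · exact ⟨f, by simpa using hη.le, 1, one_pos, fun h _ y _ =>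
      ⟨⟨y, by simpa using hη.le, 1, one_pos,
      fun q _ x => isEmptyElim x⟩, fun _ => ∅, fun x => isEmptyElim x, fun k x => isEmptyElim x⟩⟩
  obtain ⟨t, htf, ht, hcov⟩ := finite_approx_of_totallyBounded
    ((isCompact_range f.continuous).totallyBounded.subset (image_subset_range f (V ∩ L))) η hη
  lift t to Finset (Fin n → ℝ) using ht
  choose! x hxV hx using fun c (hc : c ∈ t) => htf hc
  obtain ⟨O, hO, hOd⟩ := (t.finite_toSet.image x).t2_separation
  set W : (Fin n → ℝ) → Set K := fun c => O (x c) ∩ V ∩ ball (x c) (η / 2) ∩ f ⁻¹' ball c η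
  have hW : ∀ c, IsOpen (W c) := fun c => (((hO _).2.inter hV).inter isOpen_ball).inter
    (isOpen_ball.preimage f.continuous)
  have hWx : ∀ c ∈ t, x c ∈ W c := fun c hc => ⟨⟨⟨(hO _).1, (hxV c hc).1⟩,
    mem_ball_self (half_pos hη)⟩, by rw [mem_preimage, hx c hc]; exact mem_ball_self hη⟩
  have hWd : ∀ c ∈ t, ∀ c' ∈ t, c ≠ c' → Disjoint (W c) (W c') := fun c hc c' hc' hne =>
    (hOd (mem_image_of_mem x hc) (mem_image_of_mem x hc') fun h =>
      hne (by rw [← hx c hc, ← hx c' hc', h])).mono (fun z hz => hz.1.1.1) fun z hz => hz.1.1.1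
  have hWdiam : ∀ c, ∀ z ∈ W c, ∀ z' ∈ W c, dist z z' ≤ η := fun c z hz z' hz' => by
    have h1 : dist z (x c) < η / 2 := hz.1.2
    have h2 : dist z' (x c) < η / 2 := hz'.1.2
    linarith [dist_triangle_right z z' (x c)]
  choose! C hCW hC u hu hgad using fun c (hc : c ∈ t) => hQ (W c) (fun z hz => hz.1.1.2) (hW c)
    ⟨x c, hWx c hc, (hxV c hc).2⟩
  obtain ⟨R, hR, τ, hτ, hτη, hgap⟩ := exists_radii t hη
  have hR0 : ∀ c ∈ t, 0 < R c := fun c hc => lt_trans (by positivity) (hR c hc).1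
  obtain ⟨g, hgC, hgW, hgf⟩ := exists_glue t (V := W) (C := C) (fun c _ => hW c) hC hCW hWd f
    (fun c => ContinuousMap.const K c + R c • u c)
  have hu' : ∀ c ∈ t, ∀ z, (ContinuousMap.const K c + R c • u c) z ∈ closedBall c (R c) :=
    fun c hc z => by
      rw [mem_closedBall, dist_eq_norm]
      show ‖c + R c • u c z - c‖ ≤ R c
      rw [add_sub_cancel_left, norm_smul, Real.norm_of_nonneg (hR0 c hc).le]
      exact mul_le_of_le_one_right (hR0 c hc).le (hu c hc z)
  have hgWb : ∀ c ∈ t, ∀ z ∈ W c, g z ∈ closedBall c (R c) := fun c hc z hz => by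
    refine (convex_closedBall c (R c)).segment_subset ?_ (hu' c hc z) (hgW c hc z hz)
    exact ball_subset_closedBall (ball_subset_ball (by linarith [(hR c hc).1]) hz.2)
  have hnet : ∀ z ∈ V ∩ L, ∃ c ∈ t, dist (f z) c < η := fun z hz => by
    obtain ⟨c, hc, h⟩ := mem_iUnion₂.1 (hcov (mem_image_of_mem f hz))
    exact ⟨c, hc, h⟩
  refine ⟨g, (ContinuousMap.dist_le (by positivity)).2 fun z => ?_, τ, hτ, fun h hh y hy => ?_⟩
  · by_cases hz : ∃ c ∈ t, z ∈ W c
    · obtain ⟨c, hc, hzc⟩ := hz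
      have h1 : dist (f z) c < η := hzc.2
      have h2 : dist (g z) c ≤ R c := hgWb c hc z hzc
      linarith [dist_triangle_right (g z) (f z) c, (hR c hc).2]
    · push Not at hz
      rw [hgf z hz, dist_self]
      positivity
  have hhg : ∀ z, dist (h z) (g z) < τ := fun z => (ContinuousMap.dist_apply_le_dist z).trans_lt hh
  have hk : ∀ c ∈ t, ∃ k, R c - τ ≤ |y k - c k| := fun c hc => by
    by_contra! hcon
    refine hy (hgad c hc h y c (R c) τ hτ.le (hR0 c hc) (fun z hz => ?_) ?_)
    · have := (hhg z).le
      rw [hgC c hc z hz, dist_eq_norm] at this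
      exact this
    · exact (pi_norm_lt_iff (by linarith [(hR c hc).1])).2 hcon
  have himg : ∀ z ∈ V ∩ L, ∃ c ∈ t, dist (h z) c < R c + τ := fun z hz => by
    by_cases hzW : ∃ c ∈ t, z ∈ W c
    · obtain ⟨c, hc, hzc⟩ := hzW
      have h2 : dist (g z) c ≤ R c := hgWb c hc z hzc
      exact ⟨c, hc, by linarith [dist_triangle (h z) (g z) c, hhg z]⟩
    · push Not at hzW
      obtain ⟨c, hc, h1⟩ := hnet z hz
      rw [← hgf z hzW] at h1
      exact ⟨c, hc, by linarith [dist_triangle (h z) (g z) c, hhg z, (hR c hc).1]⟩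
  have hsign : ∀ c k, ∃ σ ∈ ({1, -1} : Finset ℝ), y k - c k = σ * |y k - c k| ∧
      |y k - (c k + σ * R c)| = |(|y k - c k| - R c)| := fun c k => by
    obtain ⟨σ, hσ, h1⟩ := exists_sign_abs_eq (y k - c k)
    refine ⟨σ, hσ, h1, ?_⟩
    have h2 : y k - (c k + σ * R c) = σ * (|y k - c k| - R c) := by
      rw [mul_sub, ← h1]; ring
    rw [h2, abs_mul, abs_of_mem_signs hσ, one_mul]
  refine ⟨?_, fun k => ⋃ c ∈ {c | c ∈ t ∧ ∃ σ ∈ ({1, -1} : Finset ℝ), |y k - (c k + σ * R c)| ≤ τ},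
    W c, ?_, ?_⟩
  · have hz : ∀ k, ∃ z : ℝ, |z - y k| ≤ 3 * τ ∧ ∀ c ∈ t, ∀ σ ∈ ({1, -1} : Finset ℝ),
        |y k - (c k + σ * R c)| ≤ 5 * τ → z = y k + 3 * τ * σ := fun k => by
      by_cases hc : ∃ c ∈ t, ∃ σ ∈ ({1, -1} : Finset ℝ), |y k - (c k + σ * R c)| ≤ 5 * τ
      · obtain ⟨c, hc, σ, hσ, h1⟩ := hc
        refine ⟨y k + 3 * τ * σ, ?_, fun c' hc' σ' hσ' h2 => ?_⟩
        · rw [add_sub_cancel_left, abs_mul, abs_of_mem_signs hσ, abs_of_pos (by positivity)]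
          linarith
        · have h3 := abs_sub_le (c k + σ * R c) (y k) (c' k + σ' * R c')
          rw [abs_sub_comm _ (y k)] at h3
          rw [(hgap k c hc c' hc' σ hσ σ' hσ' (by linarith)).2]
      · push Not at hc
        refine ⟨y k, by simpa using hτ.le, fun c h1 σ h2 h3 => ?_⟩
        exact absurd h3 (hc c h1 σ h2).not_ge
    choose z hz1 hz2 using hz
    refine ⟨z, ((dist_pi_le_iff (by positivity)).2 hz1).trans (by linarith), τ, hτ, ?_⟩
    rintro q hq w hw rfl
    obtain ⟨c, hc, hwc⟩ := himg w hw
    obtain ⟨k, hk⟩ := hk c hc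
    obtain ⟨σ, hσ, h1, h2⟩ := hsign c k
    have h3 : dist z c < R c + 2 * τ := by
      linarith [dist_triangle_left z c (h w)]
    have h4 : |z k - c k| < R c + 2 * τ := (dist_le_pi_dist z c k).trans_lt h3
    rcases le_or_gt (|y k - c k|) (R c + 5 * τ) with h5 | h5
    · have h6 := hz2 k c hc σ hσ (by rw [h2, abs_le]; constructor <;> linarith)
      have h7 : z k - c k = σ * (|y k - c k| + 3 * τ) := by rw [h6]; linarith
      rw [h7, abs_mul, abs_of_mem_signs hσ, one_mul, abs_of_nonneg (by positivity)] at h4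
      linarith
    · have h6 := abs_sub_le (y k) (z k) (c k)
      rw [abs_sub_comm (y k) (z k)] at h6
      linarith [hz1 k]
  · rintro w ⟨hwy, hw⟩
    have hwy' : h w = y := hwy
    by_cases hwW : ∃ c ∈ t, w ∈ W c
    · obtain ⟨c, hc, hwc⟩ := hwW
      obtain ⟨k, hk⟩ := hk c hc
      obtain ⟨σ, hσ, h1, h2⟩ := hsign c k
      refine mem_iUnion.2 ⟨k, mem_biUnion (show c ∈ {c | _} from ⟨hc, σ, hσ, ?_⟩) hwc⟩
      have h3 : dist (g w) c ≤ R c := hgWb c hc w hwc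
      have h4 : |y k - c k| ≤ dist y c := dist_le_pi_dist y c k
      have h5 := dist_triangle y (g w) c
      have h6 := hhg w
      rw [hwy'] at h6
      rw [h2, abs_le]
      constructor <;> linarith
    · push Not at hwW
      obtain ⟨c, hc, h1⟩ := hnet w hw
      rw [← hgf w hwW] at h1
      obtain ⟨k, hk⟩ := hk c hc
      have h4 : |y k - c k| ≤ dist y c := dist_le_pi_dist y c k
      have h5 := dist_triangle y (g w) c
      have h6 := hhg w
      rw [hwy'] at h6
      linarith [(hR c hc).1]
  · intro k w hw w' hw'
    obtain ⟨c, ⟨hc, σ, hσ, h1⟩, hwc⟩ := mem_iUnion₂.1 hw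
    obtain ⟨c', ⟨hc', σ', hσ', h2⟩, hwc'⟩ := mem_iUnion₂.1 hw'
    have h3 := abs_sub_le (c k + σ * R c) (y k) (c' k + σ' * R c')
    rw [abs_sub_comm _ (y k)] at h3
    have h4 := (hgap k c hc c' hc' σ hσ σ' hσ' (by linarith)).1
    subst h4
    exact hWdiam c w hwc w' hwc'

/-- If every open subset of `V` meeting `L` has a gadget for `Q`, then for a generic map `h` the
property `Q h y` holds for all interior points `y` of the image of `V`, and it fails only for
points whose fibers have at most `n` points in `V ∩ L`. -/
theorem HasGadget.eventually_residual {K : Type u} [MetricSpace K] [CompactSpace K] {n : ℕ}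
    {Q : C(K, Fin n → ℝ) → (Fin n → ℝ) → Prop} {V L : Set K} (hV : IsOpen V)
    (hQ : ∀ U ⊆ V, IsOpen U → (U ∩ L).Nonempty → HasGadget Q U) {D : Set (Fin n → ℝ)}
    (hD : Dense D)
    (hL : ∀ᶠ h : C(K, Fin n → ℝ) in residual C(K, Fin n → ℝ), ∀ q ∈ D, ∀ x ∉ L, h x ≠ q) :
    ∀ᶠ h : C(K, Fin n → ℝ) in residual C(K, Fin n → ℝ), (∀ y ∈ interior (h '' V), Q h y) ∧
      ∀ y, ¬ Q h y → (h ⁻¹' {y} ∩ (V ∩ L)).encard ≤ n := by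
  have key : ∀ η > 0, ∀ᶠ h : C(K, Fin n → ℝ) in residual C(K, Fin n → ℝ), ∀ y, ¬ Q h y →
      (∃ z, dist z y ≤ η ∧ ∃ ρ > 0, ∀ q, dist q z < ρ → ∀ x ∈ V ∩ L, h x ≠ q) ∧
      ∃ S : Fin n → Set K, h ⁻¹' {y} ∩ (V ∩ L) ⊆ ⋃ k, S k ∧
        ∀ k, ∀ x ∈ S k, ∀ x' ∈ S k, dist x x' ≤ η := fun η hη =>
    eventually_residual_of_approx fun f ε hε => by
      obtain ⟨g, hg, τ, hτ, H⟩ := exists_approx hV hQ (η := min η (ε / 4))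
        (lt_min hη (by positivity)) f
      refine ⟨g, hg.trans (by linarith [min_le_right η (ε / 4)]), τ, hτ, fun k hk y hy => ?_⟩
      obtain ⟨⟨z, hz, h1⟩, S, hS, h2⟩ := H k hk y hy
      exact ⟨⟨z, hz.trans (min_le_left _ _), h1⟩, S, hS, fun k x hx x' hx' =>
        (h2 k x hx x' hx').trans (min_le_left _ _)⟩
  have key1 := eventually_countable_forall.2 fun m : ℕ =>
    key (1 / (m + 1 : ℝ)) Nat.one_div_pos_of_nat
  have key2 := eventually_residual_encard_le (n := n)
    (T := fun (h : C(K, Fin n → ℝ)) y => {x ∈ h ⁻¹' {y} ∩ (V ∩ L) | ¬ Q h y}) fun η hη => by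
      filter_upwards [key η hη] with h hh y
      by_cases hy : Q h y
      · exact ⟨fun _ => ∅, fun x hx => absurd hy hx.2, fun k x hx => absurd hx (notMem_empty x)⟩
      · obtain ⟨S, hS, hd⟩ := (hh y hy).2
        exact ⟨S, fun x hx => hS hx.1, hd⟩
  filter_upwards [hL, key1, key2] with h hhL h1 h2
  refine ⟨fun y hy => ?_, fun y hy => ?_⟩
  · by_contra hQy
    obtain ⟨ε, hε, hball⟩ := Metric.mem_nhds_iff.1 (mem_interior_iff_mem_nhds.1 hy)
    obtain ⟨m, hm⟩ := exists_nat_one_div_lt (half_pos hε)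
    obtain ⟨z, hz, ρ, hρ, H⟩ := (h1 m y hQy).1
    obtain ⟨q, hq, hqD⟩ := Metric.dense_iff.1 hD z (min ρ (ε / 2)) (lt_min hρ (half_pos hε))
    rw [mem_ball, lt_min_iff] at hq
    obtain ⟨x, hxV, hxq⟩ := hball (show q ∈ ball y ε by
      rw [mem_ball]; linarith [dist_triangle q z y])
    by_cases hxL : x ∈ L
    · exact H q hq.1 x ⟨hxV, hxL⟩ hxq
    · exact hhL q hqD x hxL hxq
  · refine (encard_le_encard ?_).trans (h2 y)
    exact fun x hx => ⟨hx, hy⟩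

/-! ### Formal properties of the three dimensions -/

theorem EReal.neg_one_le_zero : (-1 : EReal) ≤ 0 := by
  simp

/-- A dimension function that is monotone, and insensitive to finite sets above dimension zero. -/
structure IsFiniteStable {K : Type u} (dim : Set K → EReal) : Prop where
  mono : ∀ {A B : Set K}, A ⊆ B → dim A ≤ dim B
  empty_le : dim ∅ ≤ 0
  le_max_of_subset_union : ∀ {S A B : Set K}, S.Finite → A ⊆ S ∪ B → dim A ≤ max 0 (dim B)

/-- A dimension function for which a countable union of closed sets of dimension at most `s` can be
enlarged to a `Gδ` set of dimension at most `s`. -/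
def IsGδStable {K : Type u} [TopologicalSpace K] (dim : Set K → EReal) : Prop :=
  ∀ (s : ℝ), 0 ≤ s → ∀ E : ℕ → Set K, (∀ j, IsClosed (E j)) → (∀ j, dim (E j) ≤ s) →
    ∃ G, IsGδ G ∧ ⋃ j, E j ⊆ G ∧ dim G ≤ s

theorem IsFiniteStable.le_zero_of_finite {K : Type u} {dim : Set K → EReal}
    (h : IsFiniteStable dim) {S : Set K} (hS : S.Finite) : dim S ≤ 0 :=
  (h.le_max_of_subset_union hS (B := ∅) (by simp)).trans (max_le le_rfl h.empty_le)

theorem tdim_lt_iff {K : Type u} [MetricSpace K] {A : Set K} {k : ℕ} :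
    tdim A < (k : EReal) ↔ indBelow k A := indDim_lt_iff

theorem tdim_le_iff {K : Type u} [MetricSpace K] {A : Set K} {k : ℕ} :
    tdim A ≤ (k : EReal) - 1 ↔ indBelow k A := indDim_le_iff

theorem tdim_le_coe_iff {K : Type u} [MetricSpace K] {A : Set K} {s : ℝ} (hs : 0 ≤ s) :
    tdim A ≤ (s : EReal) ↔ indBelow (⌊s⌋₊ + 1) A := by
  constructor
  · intro h
    refine tdim_lt_iff.1 (h.trans_lt ?_)
    rw [← EReal.coe_natCast, EReal.coe_lt_coe_iff]
    exact_mod_cast Nat.lt_floor_add_one s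
  · intro h
    refine (tdim_le_iff.2 h).trans ?_
    rw [EReal.natCast_sub_one_eq, EReal.coe_le_coe_iff]
    push_cast
    linarith [Nat.floor_le hs]

theorem indBelow_of_subset_finite_union {K : Type u} [MetricSpace K] [SecondCountableTopology K]
    {S A B : Set K} (hS : S.Finite) (hA : A ⊆ S ∪ B) {k : ℕ} (hk : 1 ≤ k) (hB : indBelow k B) :
    indBelow k A := by
  obtain ⟨C, hC, hCS, hCe, -⟩ := hS.isClosed.isOpen_compl.exists_iUnion_isClosed
  have : Countable S := hS.countable
  refine indBelow_of_subset_iUnion_isClosed (ι := S ⊕ ℕ)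
    (C := Sum.elim (fun s => {(s : K)}) C) ?_ ?_ ?_
  · rintro (s | j)
    · exact isClosed_singleton
    · exact hC j
  · intro x _
    by_cases hx : x ∈ S
    · exact mem_iUnion.2 ⟨Sum.inl ⟨x, hx⟩, rfl⟩
    · have : x ∈ ⋃ j, C j := hCe ▸ hx
      obtain ⟨j, hj⟩ := mem_iUnion.1 this
      exact mem_iUnion.2 ⟨Sum.inr j, hj⟩
  · rintro (s | j)
    · refine indBelow.mono hk (hasClopenBasis_iff.1 ?_)
      intro x U _ hx
      refine ⟨univ, isClopen_univ, mem_univ _, fun y _ => ?_⟩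
      have : y = x := Subtype.ext (by
        have h1 : (y : K) = s := y.2.1
        have h2 : (x : K) = s := x.2.1
        rw [h1, h2])
      exact this ▸ hx
    · exact hB.mono_set fun x hx => (hA hx.2).resolve_left (hCS j hx.1)

theorem tdim_mono {K : Type u} [MetricSpace K] {A B : Set K} (h : A ⊆ B) : tdim A ≤ tdim B :=
  le_sInf (by rintro d ⟨n, hn, rfl⟩; exact sInf_le ⟨n, hn.mono_set h, rfl⟩)

theorem isFiniteStable_tdim {K : Type u} [MetricSpace K] [SecondCountableTopology K] :
    IsFiniteStable (tdim : Set K → EReal) where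
  mono := tdim_mono
  empty_le := by
    refine (tdim_le_iff (k := 0).2 (inferInstance : IsEmpty (∅ : Set K))).trans ?_
    rw [EReal.natCast_sub_one_eq]
    exact_mod_cast (by norm_num : (((0 : ℕ) : ℝ) - 1) ≤ 0)
  le_max_of_subset_union := by
    intro S A B hS hA
    by_contra! h
    obtain ⟨h0, h1⟩ := max_lt_iff.1 h
    obtain ⟨d, ⟨m, hm, rfl⟩, hd⟩ := sInf_lt_iff.1 h1
    have := tdim_le_iff.2 (indBelow_of_subset_finite_union hS hA (le_max_right m 1)
      (hm.mono (le_max_left m 1)))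
    rcases le_total m 1 with h2 | h2
    · rw [max_eq_right h2, EReal.natCast_sub_one_eq] at this
      refine absurd h0 (not_lt.2 (this.trans ?_))
      simp
    · rw [max_eq_left h2] at this
      exact absurd hd (not_lt.2 this)

theorem isGδStable_tdim {K : Type u} [MetricSpace K] [SecondCountableTopology K] :
    IsGδStable (tdim : Set K → EReal) := by
  intro s hs E hE hd
  have h : indBelow (⌊s⌋₊ + 1) ↥(⋃ j, E j) :=
    indBelow_of_subset_iUnion_isClosed hE subset_rfl fun j =>
      ((tdim_le_coe_iff hs).1 (hd j)).mono_set inter_subset_left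
  obtain ⟨G, hG, hEG, hGi⟩ := exists_isGδ_superset_indBelow h
  exact ⟨G, hG, hEG, (tdim_le_coe_iff hs).2 hGi⟩

theorem max_zero_hdim {K : Type u} [MetricSpace K] (A : Set K) :
    max 0 (hdim A) = ((dimH A : ℝ≥0∞) : EReal) := by
  unfold hdim
  split_ifs with h
  · subst h
    rw [dimH_empty, EReal.coe_ennreal_zero]
    exact max_eq_left EReal.neg_one_le_zero
  · exact max_eq_right (EReal.coe_ennreal_nonneg _)

theorem hdim_le_coe_iff {K : Type u} [MetricSpace K] {A : Set K} (s : ℝ≥0) :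
    hdim A ≤ ((s : ℝ) : EReal) ↔ dimH A ≤ s := by
  have h0 : (0 : EReal) ≤ ((s : ℝ) : EReal) := by exact_mod_cast s.2
  rw [← EReal.coe_ennreal_le_coe_ennreal_iff, ← max_zero_hdim]
  exact ⟨fun h => max_le h0 h, fun h => (le_max_right _ _).trans h⟩

theorem isFiniteStable_hdim {K : Type u} [MetricSpace K] :
    IsFiniteStable (hdim : Set K → EReal) where
  mono := by
    intro A B h
    unfold hdim
    split_ifs with h1 h2 h2
    · exact le_rfl
    · exact EReal.neg_one_le_zero.trans
        (EReal.coe_ennreal_nonneg _)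
    · exact absurd (subset_empty_iff.1 (h2 ▸ h)) h1
    · exact EReal.coe_ennreal_le_coe_ennreal_iff.2 (dimH_mono h)
  empty_le := (le_max_right 0 _).trans (by rw [max_zero_hdim, dimH_empty, EReal.coe_ennreal_zero])
  le_max_of_subset_union := by
    intro S A B hS hA
    refine (le_max_right 0 _).trans ?_
    rw [max_zero_hdim, max_zero_hdim, EReal.coe_ennreal_le_coe_ennreal_iff]
    refine (dimH_mono hA).trans ?_
    rw [dimH_union, hS.dimH_zero]
    simp

open MeasureTheory in
/-- Sets of zero Hausdorff measure have open covers of small size. -/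
theorem exists_isOpen_cover_of_hausdorffMeasure_eq_zero {K : Type u} [MetricSpace K]
    [MeasurableSpace K] [BorelSpace K] {A : Set K} {t : ℝ} (ht : 0 < t) (h : μH[t] A = 0)
    {ε : ℝ≥0} (hε : 0 < ε) : ∃ U : ℕ → Set K, (∀ i, IsOpen (U i)) ∧ A ⊆ ⋃ i, U i ∧
      (∀ i, ediam (U i) ≤ ε) ∧ ∑' i, ediam (U i) ^ t ≤ ε := by
  have hε2 : (0 : ℝ≥0∞) < ((ε / 2 : ℝ≥0) : ℝ≥0∞) := by
    exact_mod_cast half_pos hε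
  rw [Measure.hausdorffMeasure_apply] at h
  have h1 := h ▸ (le_iSup₂ (f := fun (r : ℝ≥0∞) (_ : 0 < r) =>
    ⨅ (t' : ℕ → Set K) (_ : A ⊆ ⋃ n, t' n) (_ : ∀ n, ediam (t' n) ≤ r),
      ∑' n, ⨆ (_ : (t' n).Nonempty), ediam (t' n) ^ t) ((ε / 2 : ℝ≥0) : ℝ≥0∞) hε2)
  have h2 := h1.trans_lt hε2
  simp only [iInf_lt_iff] at h2
  obtain ⟨C, hAC, hCd, hsum⟩ := h2
  obtain ⟨e, he, hesum⟩ := ENNReal.exists_pos_sum_of_countable' hε2.ne' ℕ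
  have key : ∀ i, ∃ η : ℝ≥0, 0 < η ∧ ediam (thickening η (C i)) ≤ ε ∧
      ediam (thickening η (C i)) ^ t ≤ (⨆ (_ : (C i).Nonempty), ediam (C i) ^ t) + e i := by
    intro i
    rcases (C i).eq_empty_or_nonempty with h0 | h0
    · refine ⟨1, one_pos, ?_⟩
      rw [h0, thickening_empty, ediam_empty, ENNReal.zero_rpow_of_pos ht]
      simp
    · have hfin : ediam (C i) ^ t < ediam (C i) ^ t + e i := by
        refine ENNReal.lt_add_right ?_ (he i).ne'
        exact ENNReal.rpow_ne_top_of_nonneg ht.le ((hCd i).trans_lt ENNReal.coe_lt_top).ne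
      have hc : Tendsto (fun η : ℝ≥0 => (ediam (C i) + 2 * η) ^ t) (𝓝 0) (𝓝 (ediam (C i) ^ t)) := by
        have : Continuous fun η : ℝ≥0 => (ediam (C i) + 2 * (η : ℝ≥0∞)) ^ t :=
          ENNReal.continuous_rpow_const.comp (continuous_const.add
            ((ENNReal.continuous_const_mul (by simp)).comp ENNReal.continuous_coe))
        simpa using this.tendsto 0
      have ev := (hc.eventually_lt_const hfin).and
        (Iic_mem_nhds (show (0 : ℝ≥0) < ε / 4 by positivity))
      have ev' : ∀ᶠ η : ℝ≥0 in 𝓝[>] (0 : ℝ≥0),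
          (ediam (C i) + 2 * (η : ℝ≥0∞)) ^ t < ediam (C i) ^ t + e i ∧
          η ∈ Iic (ε / 4) := nhdsWithin_le_nhds ev
      obtain ⟨η, ⟨hη1, hη2⟩, hη0⟩ := (ev'.and self_mem_nhdsWithin).exists
      refine ⟨η, hη0, (ediam_thickening_le η).trans ?_, ?_⟩
      · calc ediam (C i) + 2 * (η : ℝ≥0∞)
            ≤ ((ε / 2 : ℝ≥0) : ℝ≥0∞) + ((2 * (ε / 4) : ℝ≥0) : ℝ≥0∞) := by
              rw [ENNReal.coe_mul, ENNReal.coe_ofNat]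
              have h4 : (η : ℝ≥0∞) ≤ ((ε / 4 : ℝ≥0) : ℝ≥0∞) := ENNReal.coe_le_coe.2 hη2
              exact add_le_add (hCd i) (by gcongr)
          _ = ε := by
              rw [← ENNReal.coe_add]
              congr 1
              ext
              push_cast
              ring
      · rw [ciSup_pos h0]
        exact (ENNReal.rpow_le_rpow (ediam_thickening_le η) ht.le).trans hη1.le
  choose η hη0 hη1 hη2 using key
  refine ⟨fun i => thickening (η i) (C i), fun i => isOpen_thickening,
    hAC.trans (iUnion_mono fun i => self_subset_thickening (hη0 i) _), hη1, ?_⟩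
  calc ∑' i, ediam (thickening (η i) (C i)) ^ t
      ≤ ∑' i, ((⨆ (_ : (C i).Nonempty), ediam (C i) ^ t) + e i) := ENNReal.tsum_le_tsum hη2
    _ = (∑' i, (⨆ (_ : (C i).Nonempty), ediam (C i) ^ t)) + ∑' i, e i := ENNReal.tsum_add
    _ ≤ ((ε / 2 : ℝ≥0) : ℝ≥0∞) + ((ε / 2 : ℝ≥0) : ℝ≥0∞) := add_le_add hsum.le hesum.le
    _ = ε := by rw [← ENNReal.coe_add, add_halves]

open MeasureTheory in
theorem exists_isGδ_superset_dimH_le {K : Type u} [MetricSpace K] {A : Set K} {s : ℝ≥0}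
    (h : dimH A ≤ s) : ∃ G, IsGδ G ∧ A ⊆ G ∧ dimH G ≤ s := by
  borelize K
  let t : ℕ → ℝ≥0 := fun k => s + 1 / (k + 1)
  have ht : ∀ k, s < t k := fun k => lt_add_of_pos_right _ (by positivity)
  have hpos : ∀ k, (0 : ℝ) < t k := fun k => by exact_mod_cast (zero_le (a := s)).trans_lt (ht k)
  have h0 : ∀ k, μH[t k] A = 0 := fun k =>
    hausdorffMeasure_of_dimH_lt (h.trans_lt (by exact_mod_cast ht k))
  choose U hU hAU hUd hUs using fun (k m : ℕ) =>
    exists_isOpen_cover_of_hausdorffMeasure_eq_zero (hpos k) (h0 k)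
      (ε := 1 / ((m : ℝ≥0) + 1)) (by positivity)
  refine ⟨⋂ k, ⋂ m, ⋃ i, U k m i, IsGδ.iInter fun k => IsGδ.iInter fun m =>
    (isOpen_iUnion fun i => hU k m i).isGδ,
    subset_iInter fun k => subset_iInter fun m => hAU k m, ?_⟩
  have hr : Tendsto (fun m : ℕ => ((1 / ((m : ℝ≥0) + 1) : ℝ≥0) : ℝ≥0∞)) atTop (𝓝 0) := by
    have := tendsto_one_div_add_atTop_nhds_zero_nat (𝕜 := ℝ≥0)
    exact ENNReal.tendsto_coe.2 this
  have hle : ∀ k, dimH (⋂ k, ⋂ m, ⋃ i, U k m i) ≤ t k := by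
    intro k
    refine dimH_le_of_hausdorffMeasure_ne_top ?_
    have := Measure.hausdorffMeasure_le_liminf_tsum (t k) (⋂ k, ⋂ m, ⋃ i, U k m i) _ hr
      (fun m => U k m) (Eventually.of_forall fun m => hUd k m)
      (Eventually.of_forall fun m => (iInter_subset _ k).trans (iInter_subset _ m))
    have h2 : liminf (fun m : ℕ => ∑' i, ediam (U k m i) ^ (t k : ℝ)) atTop ≤ 0 := by
      rw [← hr.liminf_eq]
      exact liminf_le_liminf (Eventually.of_forall fun m => hUs k m)
    exact ((this.trans h2).trans_lt ENNReal.zero_lt_top).ne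
  have hlim : Tendsto (fun k => (t k : ℝ≥0∞)) atTop (𝓝 s) := by
    have := tendsto_one_div_add_atTop_nhds_zero_nat (𝕜 := ℝ≥0)
    have h2 := this.const_add s
    rw [add_zero] at h2
    exact ENNReal.tendsto_coe.2 h2
  exact ge_of_tendsto' hlim hle

theorem isGδStable_hdim {K : Type u} [MetricSpace K] : IsGδStable (hdim : Set K → EReal) := by
  intro s hs E _ hd
  lift s to ℝ≥0 using hs
  simp only [hdim_le_coe_iff] at hd ⊢
  exact exists_isGδ_superset_dimH_le (by rw [dimH_iUnion]; exact iSup_le hd)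

theorem packPre0_mono {K : Type u} [MetricSpace K] {h : ℝ≥0 → ℝ≥0} {A B : Set K} (hAB : A ⊆ B) :
    packPre0 h A ≤ packPre0 h B :=
  iInf₂_mono fun _ _ => iSup_mono fun _ => iSup_mono' fun hs =>
    ⟨⟨hs.1, fun p hp => ⟨hAB (hs.2.1 p hp).1, (hs.2.1 p hp).2⟩, hs.2.2⟩, le_rfl⟩

theorem IsPacking.injOn_fst {K : Type u} [MetricSpace K] {A : Set K} {δ : ℝ≥0}
    {s : Set (K × ℝ≥0)} (hs : IsPacking A δ s) : InjOn Prod.fst s := by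
  intro p hp q hq hpq
  by_contra hne
  refine disjoint_left.1 (hs.2.2 hp hq hne) (mem_closedBall_self p.2.2) ?_
  rw [hpq]
  exact mem_closedBall_self q.2.2

theorem packPre0_le_encard {K : Type u} [MetricSpace K] (t : ℝ≥0) (A : Set K) :
    packPre0 (fun r => r ^ (t : ℝ)) A ≤ A.encard := by
  refine (iInf₂_le 1 one_pos).trans (iSup₂_le fun s hs => ?_)
  calc ∑' p : s, (((p.1.2 : ℝ≥0) ^ (t : ℝ) : ℝ≥0) : ℝ≥0∞) ≤ ∑' p : s, 1 := by
        refine ENNReal.tsum_le_tsum fun p => ?_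
        exact_mod_cast NNReal.rpow_le_one (hs.2.1 p p.2).2 t.2
    _ = s.encard := ENNReal.tsum_set_one s
    _ ≤ A.encard := by
        rw [← hs.injOn_fst.encard_image]
        exact_mod_cast encard_le_encard (image_subset_iff.2 fun p hp => (hs.2.1 p hp).1)

theorem packMeasure_le_encard_add {K : Type u} [MetricSpace K] (t : ℝ≥0) {S A B : Set K}
    (hA : A ⊆ S ∪ B) : packMeasure (fun r => r ^ (t : ℝ)) A ≤
      S.encard + packMeasure (fun r => r ^ (t : ℝ)) B := by
  conv_rhs => rw [packMeasure]
  rw [ENNReal.add_iInf]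
  refine le_iInf fun c => ?_
  by_cases hc : B = ⋃ i, c i
  · rw [iInf_pos hc]
    let c' : ℕ → Set K := fun i => Nat.casesOn i (A ∩ S) fun j => c j ∩ A
    have hcov : A = ⋃ i, c' i := by
      refine subset_antisymm (fun x hx => ?_) (iUnion_subset fun i => ?_)
      · rcases hA hx with h | h
        · exact mem_iUnion.2 ⟨0, hx, h⟩
        · rw [hc] at h
          obtain ⟨j, hj⟩ := mem_iUnion.1 h
          exact mem_iUnion.2 ⟨j + 1, hj, hx⟩
      · cases i with
        | zero => exact inter_subset_left
        | succ j => exact inter_subset_right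
    refine (iInf₂_le c' hcov).trans ?_
    rw [tsum_eq_zero_add' ENNReal.summable]
    refine add_le_add ((packPre0_le_encard t _).trans ?_)
      (ENNReal.tsum_le_tsum fun i => packPre0_mono inter_subset_left)
    exact_mod_cast encard_le_encard inter_subset_right
  · rw [iInf_neg hc]
    simp

theorem packMeasure_mono {K : Type u} [MetricSpace K] (t : ℝ≥0) {A B : Set K} (h : A ⊆ B) :
    packMeasure (fun r => r ^ (t : ℝ)) A ≤ packMeasure (fun r => r ^ (t : ℝ)) B := by
  simpa using packMeasure_le_encard_add t (S := ∅) (show A ⊆ ∅ ∪ B by simpa using h)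

theorem packMeasure_empty {K : Type u} [MetricSpace K] (t : ℝ≥0) :
    packMeasure (fun r => r ^ (t : ℝ)) (∅ : Set K) = 0 := by
  refine le_antisymm ((iInf₂_le (fun _ => ∅) (by simp)).trans ?_) zero_le
  rw [ENNReal.tsum_eq_zero.2]
  intro i
  simpa using packPre0_le_encard t (∅ : Set K)

theorem le_pdim_of_packMeasure_eq_top {K : Type u} [MetricSpace K] {t : ℝ≥0} {A : Set K}
    (h : packMeasure (fun r => r ^ (t : ℝ)) A = ∞) : ((t : ℝ) : EReal) ≤ pdim A := by
  unfold pdim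
  rw [if_neg]
  · exact le_max_of_le_right (le_iSup₂ (f := fun (s : ℝ≥0)
      (_ : packMeasure (fun r => r ^ (s : ℝ)) A = ∞) => ((s : ℝ) : EReal)) t h)
  · rintro rfl
    rw [packMeasure_empty] at h
    exact ENNReal.zero_ne_top h

theorem pdim_le_iff {K : Type u} [MetricSpace K] {A : Set K} {d : EReal} (hd : 0 ≤ d) :
    pdim A ≤ d ↔ ∀ t : ℝ≥0, packMeasure (fun r => r ^ (t : ℝ)) A = ∞ → ((t : ℝ) : EReal) ≤ d := by
  refine ⟨fun h t ht => (le_pdim_of_packMeasure_eq_top ht).trans h, fun h => ?_⟩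
  unfold pdim
  split_ifs with h1
  · exact EReal.neg_one_le_zero.trans hd
  · exact max_le hd (iSup₂_le h)

theorem isFiniteStable_pdim {K : Type u} [MetricSpace K] :
    IsFiniteStable (pdim : Set K → EReal) where
  mono := by
    intro A B h
    by_cases hA : A = ∅
    · have h1 : pdim A = -1 := by unfold pdim; rw [if_pos hA]
      have h2 : -1 ≤ pdim B := by
        unfold pdim
        split_ifs
        · exact le_rfl
        · exact le_max_of_le_left EReal.neg_one_le_zero
      rw [h1]
      exact h2
    · have hB : B ≠ ∅ := fun hB => hA (subset_empty_iff.1 (hB ▸ h))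
      have h0 : 0 ≤ pdim B := by
        unfold pdim
        rw [if_neg hB]
        exact le_max_left _ _
      refine (pdim_le_iff h0).2 fun t ht => le_pdim_of_packMeasure_eq_top ?_
      exact top_le_iff.1 (ht ▸ packMeasure_mono t h)
  empty_le := (pdim_le_iff le_rfl).2 fun t ht => by
    rw [packMeasure_empty] at ht
    exact absurd ht ENNReal.zero_ne_top
  le_max_of_subset_union := by
    intro S A B hS hA
    refine (pdim_le_iff (le_max_left _ _)).2 fun t ht => le_max_of_le_right ?_
    refine le_pdim_of_packMeasure_eq_top ?_
    have := packMeasure_le_encard_add t hA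
    rw [ht, top_le_iff, ENNReal.add_eq_top] at this
    refine this.resolve_left ?_
    have := hS.encard_lt_top.ne
    simpa using this

/-! ### Packing dimension and separated sets -/

theorem exists_packPre0_eq_top_of_lt_pdim {K : Type u} [MetricSpace K] {S : Set K} {s : ℝ≥0}
    (h : ((s : ℝ) : EReal) < pdim S) :
    ∃ t : ℝ≥0, s < t ∧ packPre0 (fun r => r ^ (t : ℝ)) S = ∞ := by
  have h' : ∃ t : ℝ≥0, s < t ∧ packMeasure (fun r => r ^ (t : ℝ)) S = ∞ := by
    by_contra! hc
    refine not_le.2 h ((pdim_le_iff (by exact_mod_cast s.2)).2 fun t ht => ?_)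
    by_contra! hst
    exact hc t (by exact_mod_cast hst) ht
  obtain ⟨t, hst, ht⟩ := h'
  refine ⟨t, hst, ?_⟩
  have hle : packMeasure (fun r => r ^ (t : ℝ)) S ≤ packPre0 (fun r => r ^ (t : ℝ)) S := by
    let c : ℕ → Set K := fun i => Nat.casesOn i S fun _ => ∅
    refine (iInf₂_le c ?_).trans ?_
    · refine subset_antisymm (subset_iUnion c 0) (iUnion_subset fun i => ?_)
      cases i with
      | zero => exact subset_rfl
      | succ j => exact empty_subset _
    · rw [tsum_eq_zero_add' ENNReal.summable]
      have : ∀ i : ℕ, packPre0 (fun r => r ^ (t : ℝ)) (∅ : Set K) = 0 := fun _ =>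
        le_antisymm (by simpa using packPre0_le_encard t (∅ : Set K)) zero_le
      simp [c, this 0]
  exact top_le_iff.1 (ht ▸ hle)

/-- A set of packing dimension above `s` contains large separated sets at arbitrarily small
scales. -/
theorem exists_separated_of_lt_pdim {K : Type u} [MetricSpace K] {S : Set K} {s : ℝ≥0}
    (h : ((s : ℝ) : EReal) < pdim S) {ε₀ : ℝ≥0} (hε₀ : 0 < ε₀) :
    ∃ ε : ℝ≥0, 0 < ε ∧ ε < ε₀ ∧ ∃ P : Finset K, ↑P ⊆ S ∧ ε ^ (-(s : ℝ)) ≤ (P.card : ℝ≥0) ∧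
      (P : Set K).Pairwise fun x y => Disjoint (closedBall x (ε : ℝ)) (closedBall y (ε : ℝ)) := by
  classical
  obtain ⟨t, hst, htop⟩ := exists_packPre0_eq_top_of_lt_pdim h
  have ht0 : (0 : ℝ) < t := by exact_mod_cast (zero_le (a := s)).trans_lt hst
  by_contra! hcon
  let a : ℕ → ℝ≥0 := fun j => (1 / 2) ^ j
  let q : ℝ≥0 := (1 / 2) ^ ((t : ℝ) - s)
  have hq : q < 1 := NNReal.rpow_lt_one (by norm_num [← NNReal.coe_lt_coe])
    (sub_pos.2 (by exact_mod_cast hst))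
  let M : ℝ≥0 := (1 / 2) ^ (-(s : ℝ))
  have hprod : ∀ j, a (j + 1) ^ (-(s : ℝ)) * a j ^ (t : ℝ) = M * q ^ j := by
    intro j
    have h1 : a (j + 1) = a j * (1 / 2) := pow_succ _ _
    have h2 : a j ≠ 0 := pow_ne_zero _ (by norm_num)
    rw [h1, NNReal.mul_rpow, mul_right_comm, ← NNReal.rpow_add h2, mul_comm]
    congr 1
    simp only [a, q]
    rw [← NNReal.rpow_natCast, ← NNReal.rpow_natCast, ← NNReal.rpow_mul, ← NNReal.rpow_mul]
    congr 1
    ring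
  have hbound : packPre (fun r => r ^ (t : ℝ)) S (min (ε₀ / 2) 1) ≤
      ∑' j, ((M * q ^ j : ℝ≥0) : ℝ≥0∞) := by
    refine iSup₂_le fun σ hσ => ?_
    let G : ℕ → Set (K × ℝ≥0) := fun j => {p | a (j + 1) < p.2 ∧ p.2 ≤ a j}
    have hpt : ∀ p : σ, (((p.1.2 : ℝ≥0) ^ (t : ℝ) : ℝ≥0) : ℝ≥0∞) ≤
        ∑' j, if p.1 ∈ G j then ((a j ^ (t : ℝ) : ℝ≥0) : ℝ≥0∞) else 0 := by
      intro p
      rcases eq_or_ne p.1.2 0 with h0 | h0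
      · have h1 : ((p.1.2 : ℝ≥0) ^ (t : ℝ) : ℝ≥0) = 0 := by rw [h0, NNReal.zero_rpow ht0.ne']
        rw [h1]
        exact zero_le
      · obtain ⟨j, hj1, hj2⟩ := exists_nat_pow_near_of_lt_one (pos_iff_ne_zero.2 h0)
          ((hσ.2.1 p.1 p.2).2.trans (min_le_right _ _)) (show (0 : ℝ≥0) < 1 / 2 by norm_num)
          (by norm_num [← NNReal.coe_lt_coe])
        refine le_trans ?_ (ENNReal.le_tsum j)
        have : p.1 ∈ G j := ⟨hj1, hj2⟩
        rw [if_pos this]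
        exact_mod_cast NNReal.rpow_le_rpow hj2 ht0.le
    refine (ENNReal.tsum_le_tsum hpt).trans ?_
    rw [ENNReal.tsum_comm]
    refine ENNReal.tsum_le_tsum fun j => ?_
    rw [ENNReal.tsum_eq_iSup_sum]
    refine iSup_le fun F => ?_
    rw [← Finset.sum_filter, Finset.sum_const, nsmul_eq_mul]
    set F' := F.filter fun p => p.1 ∈ G j
    rcases F'.eq_empty_or_nonempty with h0 | ⟨p₀, hp₀⟩
    · rw [h0]; simp
    have hp₀' : p₀.1 ∈ G j := (Finset.mem_filter.1 hp₀).2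
    have hlt : a (j + 1) < ε₀ := hp₀'.1.trans_le ((hσ.2.1 p₀.1 p₀.2).2.trans
      ((min_le_left _ _).trans (half_le_self zero_le)))
    have hinj : InjOn (fun p : σ => p.1.1) F' := fun p _ q _ hpq =>
      Subtype.ext (hσ.injOn_fst p.2 q.2 hpq)
    by_contra! hlarge
    refine hcon (a (j + 1)) (pow_pos (by norm_num) _) hlt (F'.image fun p => p.1.1) ?_ ?_ ?_
    · intro x hx
      obtain ⟨p, hp, rfl⟩ := Finset.mem_image.1 (Finset.mem_coe.1 hx)
      exact (hσ.2.1 p.1 p.2).1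
    · rw [Finset.card_image_of_injOn hinj]
      have h3 : (M * q ^ j : ℝ≥0) < F'.card * a j ^ (t : ℝ) := by exact_mod_cast hlarge
      rw [← hprod] at h3
      exact (lt_of_mul_lt_mul_right h3 zero_le).le
    · intro x hx y hy hxy
      obtain ⟨p, hp, rfl⟩ := Finset.mem_image.1 (Finset.mem_coe.1 hx)
      obtain ⟨q, hq, rfl⟩ := Finset.mem_image.1 (Finset.mem_coe.1 hy)
      have hpq : p.1 ≠ q.1 := fun h => hxy (by rw [h])
      refine (hσ.2.2 p.2 q.2 hpq).mono (closedBall_subset_closedBall ?_)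
        (closedBall_subset_closedBall ?_)
      · exact_mod_cast (Finset.mem_filter.1 hp).2.1.le
      · exact_mod_cast (Finset.mem_filter.1 hq).2.1.le
  have hfin : ∑' j, ((M * q ^ j : ℝ≥0) : ℝ≥0∞) < ∞ := by
    rw [← ENNReal.coe_tsum]
    · exact ENNReal.coe_lt_top
    · exact (NNReal.summable_geometric hq).mul_left M
  have := (iInf₂_le (f := fun (δ : ℝ≥0) (_ : 0 < δ) => packPre (fun r => r ^ (t : ℝ)) S δ)
    (min (ε₀ / 2) 1) (lt_min (half_pos hε₀) one_pos)).trans_lt (hbound.trans_lt hfin)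
  exact absurd htop this.ne

theorem packPre0_eq_top_of_separated {K : Type u} [MetricSpace K] {A : Set K} {s u : ℝ≥0}
    (hus : u < s) (H : ∀ ε₀ : ℝ≥0, 0 < ε₀ → ∃ ε : ℝ≥0, 0 < ε ∧ ε < ε₀ ∧ ∃ P : Finset K,
      ↑P ⊆ closure A ∧ ε ^ (-(s : ℝ)) ≤ (P.card : ℝ≥0) ∧ (P : Set K).Pairwise fun x y =>
        Disjoint (closedBall x (ε / 2 : ℝ)) (closedBall y (ε / 2 : ℝ))) :
    packPre0 (fun r => r ^ (u : ℝ)) A = ∞ := by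
  classical
  have hsu : (0 : ℝ) < s - u := sub_pos.2 (by exact_mod_cast hus)
  refine iInf₂_eq_top.2 fun δ hδ => ENNReal.eq_top_of_forall_nnreal_le fun M => ?_
  let N : ℝ≥0 := max 1 (M * 4 ^ (u : ℝ))
  have hN : N ≠ 0 := (zero_lt_one.trans_le (le_max_left _ _)).ne'
  obtain ⟨ε, hε, hεlt, P, hPA, hcard, hdis⟩ := H (min δ (N ^ (-((s : ℝ) - u)⁻¹)))
    (lt_min hδ (NNReal.rpow_pos (pos_iff_ne_zero.2 hN)))
  have hex : ∀ x ∈ P, ∃ y ∈ A, dist x y < ε / 4 := fun x hx =>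
    mem_closure_iff.1 (hPA hx) _ (div_pos (NNReal.coe_pos.2 hε) four_pos)
  choose! g hgA hg using hex
  have hsub : ∀ x ∈ P, closedBall (g x) ((ε / 4 : ℝ≥0) : ℝ) ⊆ closedBall x (ε / 2 : ℝ) := by
    intro x hx
    refine closedBall_subset_closedBall' ?_
    have := hg x hx
    rw [dist_comm] at this
    push_cast
    linarith
  have hinj : InjOn (fun x => (g x, (ε / 4 : ℝ≥0))) (P : Set K) := by
    intro x hx y hy hxy
    by_contra hne
    have h1 : g x = g y := congrArg Prod.fst hxy
    refine disjoint_left.1 (hdis hx hy hne) (hsub x hx (mem_closedBall_self NNReal.zero_le_coe)) ?_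
    rw [h1]
    exact hsub y hy (mem_closedBall_self NNReal.zero_le_coe)
  let σ : Finset (K × ℝ≥0) := P.image fun x => (g x, (ε / 4 : ℝ≥0))
  have hσ : IsPacking A δ (σ : Set (K × ℝ≥0)) := by
    refine ⟨σ.countable_toSet, ?_, ?_⟩
    · intro p hp
      obtain ⟨x, hx, rfl⟩ := Finset.mem_image.1 (Finset.mem_coe.1 hp)
      refine ⟨hgA x hx, (div_le_self zero_le ?_).trans (hεlt.le.trans (min_le_left _ _))⟩
      norm_num [← NNReal.coe_le_coe]
    · intro p hp q hq hpq
      obtain ⟨x, hx, rfl⟩ := Finset.mem_image.1 (Finset.mem_coe.1 hp)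
      obtain ⟨y, hy, rfl⟩ := Finset.mem_image.1 (Finset.mem_coe.1 hq)
      have hxy : x ≠ y := fun h => hpq (by rw [h])
      exact (hdis hx hy hxy).mono (hsub x hx) (hsub y hy)
  refine le_trans ?_ (le_iSup₂ (f := fun (s : Set (K × ℝ≥0)) (_ : IsPacking A δ s) =>
    ∑' p : s, (((p.1.2 : ℝ≥0) ^ (u : ℝ) : ℝ≥0) : ℝ≥0∞)) _ hσ)
  have hsum : ∑' p : (σ : Set (K × ℝ≥0)), (((p.1.2 : ℝ≥0) ^ (u : ℝ) : ℝ≥0) : ℝ≥0∞)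
      = ((P.card * (ε / 4) ^ (u : ℝ) : ℝ≥0) : ℝ≥0∞) := by
    rw [Finset.tsum_subtype' σ fun p : K × ℝ≥0 => (((p.2 : ℝ≥0) ^ (u : ℝ) : ℝ≥0) : ℝ≥0∞),
      Finset.sum_image hinj]
    change ∑ _x ∈ P, (((ε / 4 : ℝ≥0) ^ (u : ℝ) : ℝ≥0) : ℝ≥0∞) = _
    rw [Finset.sum_const, nsmul_eq_mul, ENNReal.coe_mul, ENNReal.coe_natCast]
  rw [hsum]
  refine ENNReal.coe_le_coe.2 ?_
  have hεN : N ≤ ε ^ (-((s : ℝ) - u)) := by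
    have h1 : N = (N ^ (-((s : ℝ) - u)⁻¹)) ^ (-((s : ℝ) - u)) := by
      rw [← NNReal.rpow_mul, neg_mul_neg, inv_mul_cancel₀ hsu.ne', NNReal.rpow_one]
    rw [h1]
    exact NNReal.rpow_le_rpow_of_nonpos hε (hεlt.le.trans (min_le_right _ _)) (by linarith)
  calc M ≤ N / 4 ^ (u : ℝ) := by
        rw [le_div_iff₀ (NNReal.rpow_pos (by norm_num))]
        exact le_max_right _ _
    _ ≤ ε ^ (-((s : ℝ) - u)) / 4 ^ (u : ℝ) := by gcongr
    _ = ε ^ (-(s : ℝ)) * (ε / 4) ^ (u : ℝ) := by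
        rw [NNReal.div_rpow, neg_sub, sub_eq_neg_add, NNReal.rpow_add hε.ne', mul_div_assoc]
    _ ≤ P.card * (ε / 4) ^ (u : ℝ) := by gcongr

theorem le_pdim_of_separated {K : Type u} [MetricSpace K] [CompleteSpace K] {T : Set K}
    (hT : IsClosed T) (hne : T.Nonempty) {s : ℝ≥0}
    (H : ∀ U, IsOpen U → (T ∩ U).Nonempty → ∀ ε₀ : ℝ≥0, 0 < ε₀ → ∃ ε : ℝ≥0, 0 < ε ∧ ε < ε₀ ∧
      ∃ P : Finset K, ↑P ⊆ T ∩ U ∧ ε ^ (-(s : ℝ)) ≤ (P.card : ℝ≥0) ∧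
        (P : Set K).Pairwise fun x y =>
          Disjoint (closedBall x (ε / 2 : ℝ)) (closedBall y (ε / 2 : ℝ))) :
    ((s : ℝ) : EReal) ≤ pdim T := by
  have key : ∀ u < s, packMeasure (fun r => r ^ (u : ℝ)) T = ∞ := by
    intro u hu
    refine iInf₂_eq_top.2 fun c hc => ?_
    have : CompleteSpace T := hT.completeSpace_coe
    have : Nonempty T := hne.to_subtype
    obtain ⟨i, x, hx⟩ := nonempty_interior_of_iUnion_of_closed
      (f := fun i => ((↑) : T → K) ⁻¹' closure (c i)) (fun i => isClosed_closure.preimage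
        continuous_subtype_val) (eq_univ_of_forall fun x => by
          have : (x : K) ∈ ⋃ i, c i := hc ▸ x.2
          obtain ⟨i, hi⟩ := mem_iUnion.1 this
          exact mem_iUnion.2 ⟨i, subset_closure hi⟩)
    obtain ⟨V, hV, hVo, hxV⟩ := mem_interior.1 hx
    obtain ⟨U, hU, rfl⟩ := isOpen_induced_iff.1 hVo
    refine ENNReal.tsum_eq_top_of_eq_top ⟨i, packPre0_eq_top_of_separated hu fun ε₀ hε₀ => ?_⟩
    obtain ⟨ε, h1, h2, P, hP, h3, h4⟩ := H U hU ⟨x, x.2, hxV⟩ ε₀ hε₀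
    exact ⟨ε, h1, h2, P, fun y hy => hV (a := ⟨y, (hP hy).1⟩) (hP hy).2, h3, h4⟩
  by_contra! hlt
  have h0 : 0 ≤ pdim T := by
    unfold pdim
    rw [if_neg hne.ne_empty]
    exact le_max_left _ _
  obtain ⟨r, hr1, hr2⟩ := EReal.lt_iff_exists_real_btwn.1 hlt
  have hr0 : 0 ≤ r := by exact_mod_cast h0.trans hr1.le
  lift r to ℝ≥0 using hr0
  exact not_le.2 hr1 (le_pdim_of_packMeasure_eq_top (key r (by exact_mod_cast hr2)))

/-! ### The part of a space where it has large dimension, and upper bounds for fibres -/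

/-- The set of points all of whose open neighbourhoods have topological dimension at least `n`. -/
def fatSet (n : ℕ) (K : Type u) [TopologicalSpace K] : Set K :=
  (⋃₀ {U | IsOpen U ∧ indBelow n U})ᶜ

theorem isClosed_fatSet {n : ℕ} {K : Type u} [TopologicalSpace K] : IsClosed (fatSet n K) :=
  (isOpen_sUnion fun _ hU => hU.1).isClosed_compl

theorem not_indBelow_of_inter_fatSet {n : ℕ} {K : Type u} [TopologicalSpace K] {U : Set K}
    (hU : IsOpen U) (h : (U ∩ fatSet n K).Nonempty) : ¬ indBelow n U := by
  obtain ⟨x, hxU, hx⟩ := h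
  exact fun hi => hx ⟨U, ⟨hU, hi⟩, hxU⟩

theorem indBelow_compl_fatSet {n : ℕ} {K : Type u} [MetricSpace K] [SecondCountableTopology K] :
    indBelow n ↥(fatSet n K)ᶜ := by
  rw [fatSet, compl_compl]
  obtain ⟨T, hT, hTS, hTe⟩ := isOpen_sUnion_countable {U : Set K | IsOpen U ∧ indBelow n U}
    fun U hU => hU.1
  rw [← hTe]
  choose C hC hCU hCe _ using fun U : T => (hTS U.2).1.exists_iUnion_isClosed
  have := hT.to_subtype
  refine indBelow_of_subset_iUnion_isClosed (C := fun p : T × ℕ => C p.1 p.2)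
    (fun p => hC p.1 p.2) ?_ fun p => (hTS p.1.2).2.mono_set (inter_subset_left.trans (hCU p.1 p.2))
  rintro x ⟨U, hU, hx⟩
  have : x ∈ ⋃ j, C ⟨U, hU⟩ j := hCe ⟨U, hU⟩ ▸ hx
  obtain ⟨j, hj⟩ := mem_iUnion.1 this
  exact mem_iUnion.2 ⟨(⟨U, hU⟩, j), hj⟩

theorem IsFSigmaIn.exists_monotone {K : Type u} [MetricSpace K] {F A : Set K}
    (h : IsFSigmaIn F A) (hA : IsOpen A) :
    ∃ E : ℕ → Set K, Monotone E ∧ (∀ j, IsClosed (E j)) ∧ F = ⋃ j, E j := by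
  obtain ⟨C, hC, rfl⟩ := h
  obtain ⟨B, hB, -, hBe, hBm⟩ := hA.exists_iUnion_isClosed
  refine ⟨fun j => ⋃ i ∈ Iic j, C i ∩ B j, ?_, ?_, ?_⟩
  · intro j k hjk
    exact iUnion₂_subset fun i hi => subset_trans (inter_subset_inter_right _ (hBm hjk))
      (subset_biUnion_of_mem (u := fun i => C i ∩ B k) (show i ∈ Iic k from le_trans hi hjk))
  · exact fun j => (finite_Iic j).isClosed_biUnion fun i _ => (hC i).inter (hB j)
  · rw [← hBe]
    ext x
    simp only [mem_iUnion, mem_inter_iff, mem_Iic, exists_prop]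
    constructor
    · rintro ⟨i, hx, j, hj⟩
      exact ⟨max i j, i, le_max_left _ _, hx, hBm (le_max_right _ _) hj⟩
    · rintro ⟨j, i, -, hx, hj⟩
      exact ⟨i, hx, j, hj⟩

theorem encard_iUnion_le_of_monotone {α : Type*} {S : ℕ → Set α} (hS : Monotone S) {N : ℕ∞}
    (h : ∀ j, (S j).encard ≤ N) : (⋃ j, S j).encard ≤ N := by
  by_contra! hlt
  have hN : N ≠ ⊤ := (hlt.trans_le le_top).ne
  obtain ⟨t, ht, hcard⟩ := exists_subset_encard_eq (Order.add_one_le_of_lt hlt)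
  have hfin : t.Finite := finite_of_encard_le_coe (k := N.toNat + 1) (by
    rw [hcard]
    push_cast
    rw [ENat.natCast_toNat hN])
  obtain ⟨j, hj⟩ := Directed.exists_mem_subset_of_finset_subset_biUnion hS.directed_le
    (s := hfin.toFinset) (by simpa using ht)
  rw [hfin.coe_toFinset] at hj
  have := (hcard ▸ encard_le_encard hj).trans (h j)
  exact absurd (Order.add_one_le_iff_of_not_isMax (by simpa using hN) |>.1 this) (lt_irrefl _)

theorem eventually_encard_fiber_iUnion_le {K : Type u} [MetricSpace K] [CompactSpace K] {n : ℕ}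
    {E : ℕ → Set K} (hE : Monotone E) (hc : ∀ j, IsClosed (E j)) (h : ∀ j, indBelow n (E j)) :
    ∀ᶠ f : C(K, Fin n → ℝ) in residual C(K, Fin n → ℝ),
      ∀ y, (⇑f ⁻¹' {y} ∩ ⋃ j, E j).encard ≤ n := by
  filter_upwards [eventually_countable_forall.2 fun j =>
    (zeroDimCover_iff.2 (h j)).eventually_encard_fiber_le (hc j)] with f hf y
  rw [inter_iUnion]
  exact encard_iUnion_le_of_monotone (fun j k hjk => inter_subset_inter_right _ (hE hjk))
    fun j => hf j y

theorem eventually_encard_fiber_compl_fatSet_le {K : Type u} [MetricSpace K] [CompactSpace K]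
    {n : ℕ} : ∀ᶠ f : C(K, Fin n → ℝ) in residual C(K, Fin n → ℝ),
      ∀ y, (⇑f ⁻¹' {y} ∩ (fatSet n K)ᶜ).encard ≤ n := by
  obtain ⟨C, hC, hCL, hCe, hCm⟩ :=
    (isClosed_fatSet (n := n) (K := K)).isOpen_compl.exists_iUnion_isClosed
  rw [← hCe]
  exact eventually_encard_fiber_iUnion_le hCm hC fun j => indBelow_compl_fatSet.mono_set (hCL j)

theorem eventually_forall_mem_fatSet {K : Type u} [MetricSpace K] [CompactSpace K]
    {n : ℕ} {D : Set (Fin n → ℝ)} (hD : D.Countable) :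
    ∀ᶠ f : C(K, Fin n → ℝ) in residual C(K, Fin n → ℝ), ∀ q ∈ D, ∀ x ∉ fatSet n K, f x ≠ q := by
  obtain ⟨C, hC, hCL, hCe, -⟩ :=
    (isClosed_fatSet (n := n) (K := K)).isOpen_compl.exists_iUnion_isClosed
  rw [eventually_countable_ball hD]
  intro q _
  have : ∀ᶠ f : C(K, Fin n → ℝ) in residual C(K, Fin n → ℝ), ∀ j, ∀ x ∈ C j, f x ≠ q :=
    eventually_countable_forall.2 fun j => residual_of_dense_open
      (isOpen_setOf_forall_ne (hC j).isCompact q)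
      ((zeroDimCover_iff.2 (indBelow_compl_fatSet.mono_set (hCL j))).dense_forall_ne q)
  filter_upwards [this] with f hf x hx
  have hx' : x ∈ ⋃ j, C j := hCe ▸ hx
  obtain ⟨j, hj⟩ := mem_iUnion.1 hx'
  exact hf j x hj

theorem dStar_mono {K : Type u} [MetricSpace K] {dim : Set K → EReal} (hd : IsFiniteStable dim)
    {n : ℕ} {A B : Set K} (h : A ⊆ B) : dStar dim n A ≤ dStar dim n B := by
  refine le_sInf ?_
  rintro d ⟨F, ⟨C, hC, rfl⟩, hF, rfl⟩
  refine sInf_le_of_le ⟨⋃ i, C i ∩ A, ⟨C, hC, rfl⟩, ?_, rfl⟩ (hd.mono ?_)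
  · exact (tdim_mono (iUnion_mono fun i => inter_subset_inter_right _ h)).trans hF
  · rintro x ⟨hxA, hx⟩
    refine ⟨h hxA, fun hx' => hx ?_⟩
    obtain ⟨i, hi⟩ := mem_iUnion.1 hx'
    exact mem_iUnion.2 ⟨i, hi.1, hxA⟩

/-- Generically all fibres have dimension at most `dStar`. -/
theorem eventually_dim_fiber_le {K : Type u} [MetricSpace K] [CompactSpace K] {n : ℕ}
    {dim : Set K → EReal} (hd : IsFiniteStable dim) {A : Set K} (hA : IsOpen A) :
    ∀ᶠ f : C(K, Fin n → ℝ) in residual C(K, Fin n → ℝ),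
      ∀ y, dim (⇑f ⁻¹' {y} ∩ A) ≤ max 0 (dStar dim n A) := by
  have hne : {d : EReal | ∃ F : Set K, IsFSigmaIn F A ∧ tdim F ≤ (n : EReal) - 1 ∧
      d = dim (A \ F)}.Nonempty :=
    ⟨_, ∅, ⟨fun _ => ∅, fun _ => isClosed_empty, by simp⟩, tdim_le_iff.2
      (indBelow.mono (Nat.zero_le n) (inferInstance : IsEmpty (∅ : Set K))), rfl⟩
  obtain ⟨u, -, hu, hmem⟩ := exists_seq_tendsto_sInf hne (OrderBot.bddBelow _)
  choose F hF hFd huF using hmem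
  have key : ∀ k, ∀ᶠ f : C(K, Fin n → ℝ) in residual C(K, Fin n → ℝ),
      ∀ y, dim (⇑f ⁻¹' {y} ∩ A) ≤ max 0 (u k) := by
    intro k
    obtain ⟨E, hE, hEc, hEF⟩ := (hF k).exists_monotone hA
    have hi : indBelow n (F k) := tdim_le_iff.1 (hFd k)
    filter_upwards [eventually_encard_fiber_iUnion_le hE hEc fun j =>
      hi.mono_set (hEF ▸ subset_iUnion E j)] with f hf y
    rw [huF k]
    rw [← hEF] at hf
    refine hd.le_max_of_subset_union (finite_of_encard_le_coe (hf y)) ?_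
    intro x hx
    by_cases hxF : x ∈ F k
    · exact Or.inl ⟨hx.1, hxF⟩
    · exact Or.inr ⟨hx.2, hxF⟩
  filter_upwards [eventually_countable_forall.2 key] with f hf y
  exact ge_of_tendsto' (tendsto_const_nhds.max hu) fun k => hf k y

/-- For topological and Hausdorff dimension, open sets with large `dStar` carry gadgets forcing
fibres of large dimension. -/
theorem IsGδStable.hasGadget {K : Type u} [MetricSpace K] [CompactSpace K] {n : ℕ}
    {dim : Set K → EReal} (hd : IsFiniteStable dim) (hG : IsGδStable dim) {U : Set K}
    (hU : IsOpen U) {s : ℝ} (hs0 : 0 ≤ s) (hs : (s : EReal) < dStar dim n U) :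
    HasGadget (fun (h : C(K, Fin n → ℝ)) y => (s : EReal) < dim (h ⁻¹' {y})) U := by
  obtain ⟨C, hC, hCU, hCe, -⟩ := hU.exists_iUnion_isClosed
  have hex : ∃ j, ¬ Dense {f : C(K, Fin n → ℝ) | dim (f ⁻¹' {0} ∩ C j) ≤ s} := by
    by_contra! hdense
    choose T hTs hTc hTd using fun j => (hdense j).exists_countable_dense_subset
    have : ∀ j, Countable (T j) := fun j => (hTc j).to_subtype
    have : Nonempty (Σ j, T j) := ⟨⟨0, ⟨_, (hTd 0).nonempty.some_mem⟩⟩⟩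
    obtain ⟨e, he⟩ := exists_surjective_nat (Σ j, T j)
    obtain ⟨G, hGδ, hEG, hGs⟩ := hG s hs0
      (fun i => (e i).2.1 ⁻¹' {0} ∩ C (e i).1)
      (fun i => (isClosed_singleton.preimage (e i).2.1.continuous).inter (hC _))
      (fun i => hTs _ (e i).2.2)
    obtain ⟨O, hO, rfl⟩ := isGδ_iff_eq_iInter_nat.1 hGδ
    have hF : indBelow n ↥(⋃ l, (O l)ᶜ ∩ U) := by
      refine indBelow_of_subset_iUnion_isClosed (C := fun p : ℕ × ℕ => (O p.1)ᶜ ∩ C p.2)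
        (fun p => (hO p.1).isClosed_compl.inter (hC p.2)) ?_ ?_
      · intro x hx
        obtain ⟨l, hl, hxU⟩ := mem_iUnion.1 hx
        rw [← hCe] at hxU
        obtain ⟨j, hj⟩ := mem_iUnion.1 hxU
        exact mem_iUnion.2 ⟨(l, j), hl, hj⟩
      · rintro ⟨l, j⟩
        refine indBelow.mono_set inter_subset_left (indBelow_of_dense_forall_ne
          ((hO l).isClosed_compl.inter (hC j)) ((hTd j).mono fun f hf x hx h0 => hx.1 ?_))
        obtain ⟨i, hi⟩ := he ⟨j, f, hf⟩
        have : x ∈ ⋃ i, (e i).2.1 ⁻¹' {0} ∩ C (e i).1 :=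
          mem_iUnion.2 ⟨i, by rw [hi]; exact ⟨h0, hx.2⟩⟩
        exact mem_iInter.1 (hEG this) l
    have hle : dStar dim n U ≤ dim (U \ ⋃ l, (O l)ᶜ ∩ U) :=
      sInf_le ⟨_, ⟨_, fun l => (hO l).isClosed_compl, rfl⟩, tdim_le_iff.2 hF, rfl⟩
    refine not_le.2 hs (hle.trans ((hd.mono ?_).trans hGs))
    rintro x ⟨hxU, hx⟩
    refine mem_iInter.2 fun l => ?_
    by_contra hl
    exact hx (mem_iUnion.2 ⟨l, hl, hxU⟩)
  obtain ⟨j, hj⟩ := hex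
  simp only [Metric.dense_iff, not_forall, not_nonempty_iff_eq_empty] at hj
  obtain ⟨f₀, δ, hδ, hemp⟩ := hj
  refine (hasGadget_of_forall_dist_lt (S := fun A => (s : EReal) < dim A) (hCU j) (hC j) f₀ hδ
    fun g hg => ?_).mono subset_rfl fun _ _ hf => lt_of_lt_of_le hf (hd.mono inter_subset_left)
  by_contra! hle
  have hmem : g ∈ ball f₀ δ ∩ {f | dim (f ⁻¹' {0} ∩ C j) ≤ s} := ⟨hg, hle⟩
  rw [hemp] at hmem
  exact hmem

/-! ### Lower bounds for the packing dimension of fibres -/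

theorem exists_hasGadget_mem_interior_image {K : Type u} [MetricSpace K] [CompactSpace K] {n : ℕ}
    {U : Set K} (hU : IsOpen U) (hn : ¬ indBelow n U) : ∃ C ⊆ U, IsClosed C ∧
      HasGadget (fun (h : C(K, Fin n → ℝ)) y => y ∈ interior (h '' C)) U := by
  obtain ⟨C, hCU, hC, f₀, δ, hδ, hf₀⟩ := exists_stable_zero hU hn
  refine ⟨C, hCU, hC, ?_⟩
  obtain ⟨D, hDU, hD, t, ht, H⟩ := hasGadget_of_forall_dist_lt (S := Set.Nonempty) hCU hC f₀ hδ hf₀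
  refine ⟨D, hDU, hD, t, ht, fun h y c R τ hτ hR hh hy => ?_⟩
  refine mem_interior.2 ⟨ball c (R - τ), fun z hz => ?_, isOpen_ball, mem_ball_iff_norm.2 hy⟩
  obtain ⟨x, hx, hxC⟩ := H h z c R τ hτ hR hh (mem_ball_iff_norm.1 hz)
  exact ⟨x, hxC, hx⟩

/-- There are many points, separated at a scale below `ε₀`, near which there are closed subsets of
`V` whose image under `h` is a neighbourhood of `y`. -/
def HasSeparatedCovers {K : Type u} [MetricSpace K] {n : ℕ} (V : Set K) (ε₀ s : ℝ≥0)
    (h : C(K, Fin n → ℝ)) (y : Fin n → ℝ) : Prop :=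
  ∃ ε : ℝ≥0, 0 < ε ∧ ε < ε₀ ∧ ∃ P : Finset K, ε ^ (-(s : ℝ)) ≤ (P.card : ℝ≥0) ∧
    ((P : Set K).Pairwise fun x y => Disjoint (closedBall x (ε : ℝ)) (closedBall y (ε : ℝ))) ∧
    ∀ x ∈ P, ∃ C ⊆ V ∩ ball x (ε / 2 : ℝ), IsClosed C ∧ y ∈ interior (h '' C)

theorem hasGadget_hasSeparatedCovers {K : Type u} [MetricSpace K] [CompactSpace K] {n : ℕ}
    {U : Set K} (hU : IsOpen U) {s : ℝ≥0} (hs : ((s : ℝ) : EReal) < dStar pdim n U) {ε₀ : ℝ≥0}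
    (hε₀ : 0 < ε₀) :
    HasGadget (fun (h : C(K, Fin n → ℝ)) y => HasSeparatedCovers U ε₀ s h y) U := by
  have hs' : ((s : ℝ) : EReal) < pdim (U ∩ fatSet n K) := by
    refine hs.trans_le (sInf_le ?_)
    obtain ⟨C, hC, hCL, hCe, -⟩ :=
      (isClosed_fatSet (n := n) (K := K)).isOpen_compl.exists_iUnion_isClosed
    refine ⟨⋃ i, C i ∩ U, ⟨C, hC, rfl⟩, tdim_le_iff.2 (indBelow_compl_fatSet.mono_set
      (iUnion_subset fun i => inter_subset_left.trans (hCL i))), ?_⟩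
    rw [← iUnion_inter, hCe]
    congr 1
    ext x
    simp only [mem_inter_iff, Set.mem_sdiff, mem_compl_iff]
    tauto
  obtain ⟨ε, hε, hεlt, P, hPU, hcard, hdis⟩ := exists_separated_of_lt_pdim hs' hε₀
  have hε' : (0 : ℝ) < ε / 2 := half_pos (NNReal.coe_pos.2 hε)
  have hO : ∀ x ∈ P, ∃ C ⊆ U ∩ ball x (ε / 2 : ℝ), IsClosed C ∧
      HasGadget (fun (h : C(K, Fin n → ℝ)) y => y ∈ interior (h '' C)) (U ∩ ball x (ε / 2 : ℝ)) :=
    fun x hx => exists_hasGadget_mem_interior_image (hU.inter isOpen_ball)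
      (not_indBelow_of_inter_fatSet (hU.inter isOpen_ball)
        ⟨x, ⟨(hPU hx).1, mem_ball_self hε'⟩, (hPU hx).2⟩)
  choose! C hCU hC D hDU hD t ht H using hO
  have hballs : ∀ x ∈ P, ∀ y ∈ P, x ≠ y →
      Disjoint (U ∩ ball x (ε / 2 : ℝ)) (U ∩ ball y (ε / 2 : ℝ)) := fun x hx y hy hxy =>
    (hdis hx hy hxy).mono
      (inter_subset_right.trans (ball_subset_closedBall.trans (closedBall_subset_closedBall
        (half_le_self NNReal.zero_le_coe))))
      (inter_subset_right.trans (ball_subset_closedBall.trans (closedBall_subset_closedBall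
        (half_le_self NNReal.zero_le_coe))))
  obtain ⟨g, hgD, hgO, hg0⟩ := exists_glue P (V := fun x => U ∩ ball x (ε / 2 : ℝ)) (C := D)
    (fun x _ => hU.inter isOpen_ball) hD hDU hballs 0 t
  refine ⟨⋃ x ∈ P, D x, iUnion₂_subset fun x hx => (hDU x hx).trans inter_subset_left,
    P.finite_toSet.isClosed_biUnion hD, g, fun z => ?_, fun h y c R τ hτ hR hh hy => ?_⟩
  · by_cases hz : ∃ x ∈ P, z ∈ U ∩ ball x (ε / 2 : ℝ)
    · obtain ⟨x, hx, hzx⟩ := hz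
      have h0 : (0 : Fin n → ℝ) ∈ closedBall (0 : Fin n → ℝ) 1 := by simp
      have h1 : t x z ∈ closedBall (0 : Fin n → ℝ) 1 := by simpa using ht x hx z
      simpa using (convex_closedBall (0 : Fin n → ℝ) 1).segment_subset h0 h1 (hgO x hx z hzx)
    · push Not at hz
      rw [hg0 z hz]
      simp
  · refine ⟨ε, hε, hεlt, P, hcard, hdis, fun x hx => ⟨C x, hCU x hx, hC x hx,
      H x hx h y c R τ hτ hR (fun z hz => ?_) hy⟩⟩
    rw [← hgD x hx z hz]
    exact hh z (mem_biUnion (show x ∈ (P : Set K) from hx) hz)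

theorem exists_countable_nhds_family (K : Type u) [MetricSpace K] [CompactSpace K] :
    ∃ B : Set (Set K), B.Countable ∧ (∀ V ∈ B, IsOpen V) ∧
      ∀ C O : Set K, IsClosed C → IsOpen O → C ⊆ O → ∃ V ∈ B, C ⊆ V ∧ closure V ⊆ O := by
  refine ⟨sUnion '' {t | t.Finite ∧ t ⊆ countableBasis K},
    (countable_ofPred_finite_subset (countable_countableBasis K)).image _, ?_, ?_⟩
  · rintro _ ⟨t, ⟨-, ht⟩, rfl⟩
    exact isOpen_sUnion fun W hW => isOpen_of_mem_countableBasis (ht hW)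
  · intro C O hC hO hCO
    obtain ⟨W, hW, hCW, hWO⟩ := normal_exists_closure_subset hC hO hCO
    have hex : ∀ x ∈ C, ∃ b ∈ countableBasis K, x ∈ b ∧ b ⊆ W := fun x hx =>
      (isBasis_countableBasis K).exists_subset_of_mem_open (hCW hx) hW
    choose! b hb hxb hbW using hex
    obtain ⟨s, hCs⟩ := hC.isCompact.elim_nhds_subcover' (fun x _ => b x) fun x hx =>
      (isOpen_of_mem_countableBasis (hb x hx)).mem_nhds (hxb x hx)
    refine ⟨_, ⟨(fun x : C => b x) '' (s : Set C), ⟨s.finite_toSet.image _, ?_⟩, rfl⟩, ?_, ?_⟩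
    · rintro _ ⟨x, -, rfl⟩
      exact hb x x.2
    · simpa [sUnion_image] using hCs
    · refine (closure_mono ?_).trans hWO
      rw [sUnion_image]
      exact iUnion₂_subset fun x _ => hbW x x.2

/-- If the images of sets from a rich family contain separated families of covers around interior
points, then fibres over interior points have large packing dimension. -/
theorem le_pdim_fiber_of_hasSeparatedCovers {K : Type u} [MetricSpace K] [CompactSpace K] {n : ℕ}
    {B : Set (Set K)} (hBo : ∀ V ∈ B, IsOpen V)
    (hB : ∀ C O : Set K, IsClosed C → IsOpen O → C ⊆ O → ∃ V ∈ B, C ⊆ V ∧ closure V ⊆ O)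
    {s : ℝ≥0} {h : C(K, Fin n → ℝ)} {y : Fin n → ℝ}
    (H : ∀ V ∈ B, y ∈ interior (h '' V) → ∀ m : ℕ, HasSeparatedCovers V (1 / ((m : ℝ≥0) + 1)) s h y)
    (hy : y ∈ interior (range h)) : ((s : ℝ) : EReal) ≤ pdim (h ⁻¹' {y}) := by
  classical
  let T : Set K := {x | ∀ V ∈ B, x ∈ V → y ∈ interior (h '' V)}
  have hsmall : ∀ ε₀ : ℝ≥0, 0 < ε₀ → ∃ m : ℕ, 1 / ((m : ℝ≥0) + 1) < ε₀ := fun ε₀ hε₀ => by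
    obtain ⟨m, hm⟩ := exists_nat_one_div_lt (NNReal.coe_pos.2 hε₀)
    exact ⟨m, by rw [← NNReal.coe_lt_coe]; push_cast; exact hm⟩
  have hT : IsClosed T := by
    rw [← isOpen_compl_iff]
    have : Tᶜ = ⋃₀ {V | V ∈ B ∧ y ∉ interior (h '' V)} := by
      ext x
      simp only [T, mem_compl_iff, mem_ofPred_eq, not_forall, mem_sUnion]
      constructor
      · rintro ⟨V, hV, hx, hyV⟩
        exact ⟨V, ⟨hV, hyV⟩, hx⟩
      · rintro ⟨V, ⟨hV, hyV⟩, hx⟩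
        exact ⟨V, hV, hx, hyV⟩
    rw [this]
    exact isOpen_sUnion fun V hV => hBo V hV.1
  have hTy : T ⊆ h ⁻¹' {y} := by
    intro x hx
    by_contra hne
    obtain ⟨V, hV, hxV, hVO⟩ := hB {x} {z | h z ≠ y} isClosed_singleton
      (isOpen_ne_fun h.continuous continuous_const) (by simpa using hne)
    obtain ⟨z, hz, hzy⟩ := interior_subset (hx V hV (hxV rfl))
    exact hVO (subset_closure hz) hzy
  have hstep : ∀ V : {V : Set K // V ∈ B ∧ y ∈ interior (h '' V)}, ∀ m : ℕ,
      ∃ V' : {V : Set K // V ∈ B ∧ y ∈ interior (h '' V)}, closure V'.1 ⊆ V.1 ∧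
        ∃ x, V'.1 ⊆ ball x (1 / ((m : ℝ) + 1)) := by
    rintro ⟨V, hV, hyV⟩ m
    obtain ⟨ε, hε, hεlt, P, hcard, -, hP⟩ := H V hV hyV m
    have hPne : P.Nonempty := by
      rw [← Finset.card_pos]
      have : (0 : ℝ≥0) < P.card := (NNReal.rpow_pos hε).trans_le hcard
      exact_mod_cast this
    obtain ⟨x, hx⟩ := hPne
    obtain ⟨C, hCV, hC, hyC⟩ := hP x hx
    obtain ⟨V', hV', hCV', hV'V⟩ := hB C _ hC ((hBo V hV).inter isOpen_ball) hCV
    refine ⟨⟨V', hV', interior_mono (image_mono hCV') hyC⟩, hV'V.trans inter_subset_left, x,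
      subset_closure.trans (hV'V.trans (inter_subset_right.trans (ball_subset_ball ?_)))⟩
    have h1 : (ε : ℝ) < 1 / ((m : ℝ) + 1) := by
      have := NNReal.coe_lt_coe.2 hεlt
      push_cast at this
      exact this
    exact (half_le_self NNReal.zero_le_coe).trans h1.le
  choose nxt hnxt hball using hstep
  have hmeet : ∀ V ∈ B, y ∈ interior (h '' V) → (T ∩ V).Nonempty := by
    intro V hV hyV
    let W : ℕ → {V : Set K // V ∈ B ∧ y ∈ interior (h '' V)} := fun k =>
      Nat.rec ⟨V, hV, hyV⟩ (fun m V => nxt V m) k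
    have hW : ∀ k, closure (W (k + 1)).1 ⊆ (W k).1 := fun k => hnxt (W k) k
    have hWb : ∀ k, ∃ x, (W (k + 1)).1 ⊆ ball x (1 / ((k : ℝ) + 1)) := fun k => hball (W k) k
    obtain ⟨x, hx⟩ := IsCompact.nonempty_iInter_of_sequence_nonempty_isCompact_isClosed
      (fun k => closure (W (k + 1)).1) (fun k => (hW (k + 1)).trans subset_closure)
      (fun k => by
        have := (W (k + 1)).2.2
        obtain ⟨z, hz, -⟩ := interior_subset this
        exact ⟨z, subset_closure hz⟩) isClosed_closure.isCompact (fun k => isClosed_closure)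
    have hxW : ∀ k, x ∈ (W k).1 := fun k => hW k (mem_iInter.1 hx k)
    refine ⟨x, fun V' hV' hxV' => ?_, hxW 0⟩
    obtain ⟨r, hr, hrV⟩ := Metric.isOpen_iff.1 (hBo V' hV') x hxV'
    obtain ⟨k, hk⟩ := exists_nat_one_div_lt (half_pos hr)
    obtain ⟨z, hz⟩ := hWb k
    refine interior_mono (image_mono (fun w hw => hrV ?_)) (W (k + 1)).2.2
    have h1 := mem_ball.1 (hz hw)
    have h2 := mem_ball.1 (hz (hxW (k + 1)))
    rw [mem_ball]
    linarith [dist_triangle_right w x z]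
  obtain ⟨V₀, hV₀, hV₀u, -⟩ := hB univ univ isClosed_univ isOpen_univ subset_rfl
  refine le_trans (le_pdim_of_separated hT ?_ ?_) (isFiniteStable_pdim.mono hTy)
  · refine (hmeet V₀ hV₀ ?_).mono inter_subset_left
    rwa [univ_subset_iff.1 hV₀u, image_univ]
  · rintro U hU ⟨x, hxT, hxU⟩ ε₀ hε₀
    obtain ⟨V, hV, hxV, hVU⟩ := hB {x} U isClosed_singleton hU (by simpa using hxU)
    obtain ⟨m, hm⟩ := hsmall ε₀ hε₀
    obtain ⟨ε, hε, hεlt, P, hcard, hdis, hP⟩ := H V hV (hxT V hV (hxV rfl)) m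
    have hex : ∀ z ∈ P, ∃ w ∈ T ∩ V, dist w z < ε / 2 := by
      intro z hz
      obtain ⟨C, hCV, hC, hyC⟩ := hP z hz
      obtain ⟨V', hV', hCV', hV'V⟩ := hB C _ hC ((hBo V hV).inter isOpen_ball) hCV
      obtain ⟨w, hwT, hwV'⟩ := hmeet V' hV' (interior_mono (image_mono hCV') hyC)
      exact ⟨w, ⟨hwT, (hV'V (subset_closure hwV')).1⟩, (hV'V (subset_closure hwV')).2⟩
    choose! g hgT hg using hex
    have hsub : ∀ z ∈ P, closedBall (g z) (ε / 2 : ℝ) ⊆ closedBall z ε := fun z hz =>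
      closedBall_subset_closedBall' (by linarith [hg z hz])
    have hinj : InjOn g (P : Set K) := by
      intro z hz w hw hzw
      by_contra hne
      refine disjoint_left.1 (hdis hz hw hne) (hsub z hz (mem_closedBall_self ?_)) ?_
      · exact (half_pos (NNReal.coe_pos.2 hε)).le
      · rw [hzw]
        exact hsub w hw (mem_closedBall_self (half_pos (NNReal.coe_pos.2 hε)).le)
    refine ⟨ε, hε, hεlt.trans hm, P.image g, ?_, ?_, ?_⟩
    · intro w hw
      obtain ⟨z, hz, rfl⟩ := Finset.mem_image.1 (Finset.mem_coe.1 hw)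
      exact ⟨(hgT z hz).1, hVU (subset_closure (hgT z hz).2)⟩
    · rwa [Finset.card_image_of_injOn hinj]
    · intro w hw w' hw' hne
      obtain ⟨z, hz, rfl⟩ := Finset.mem_image.1 (Finset.mem_coe.1 hw)
      obtain ⟨z', hz', rfl⟩ := Finset.mem_image.1 (Finset.mem_coe.1 hw')
      have : z ≠ z' := fun h => hne (by rw [h])
      exact (hdis hz hz' this).mono (hsub z hz) (hsub z' hz')

/-! ### Generic fibres -/

theorem IsGδStable.eventually_le_dim_fiber {K : Type u} [MetricSpace K] [CompactSpace K] {n : ℕ}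
    {dim : Set K → EReal} (hd : IsFiniteStable dim) (hG : IsGδStable dim)
    (hU : ∀ U : Set K, IsOpen U → (U ∩ fatSet n K).Nonempty → dStar dim n U = dStar dim n univ)
    {s : ℝ≥0} (hs : ((s : ℝ) : EReal) < dStar dim n univ) :
    ∀ᶠ h : C(K, Fin n → ℝ) in residual C(K, Fin n → ℝ),
      ∀ y ∈ interior (range h), ((s : ℝ) : EReal) ≤ dim (h ⁻¹' {y}) := by
  obtain ⟨D, hDc, hD⟩ := exists_countable_dense (Fin n → ℝ)
  filter_upwards [HasGadget.eventually_residual (V := univ) (L := fatSet n K) isOpen_univ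
    (fun U _ hUo hUL => hG.hasGadget hd hUo s.2 (by rwa [hU U hUo hUL])) hD
    (eventually_forall_mem_fatSet hDc)] with h hh y hy
  rw [← image_univ] at hy
  exact (hh.1 y hy).le

theorem HasSeparatedCovers.mono {K : Type u} [MetricSpace K] {n : ℕ} {U V : Set K} {ε₀ s : ℝ≥0}
    {h : C(K, Fin n → ℝ)} {y : Fin n → ℝ} (H : HasSeparatedCovers U ε₀ s h y) (hUV : U ⊆ V) :
    HasSeparatedCovers V ε₀ s h y := by
  obtain ⟨ε, h1, h2, P, h3, h4, h5⟩ := H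
  refine ⟨ε, h1, h2, P, h3, h4, fun x hx => ?_⟩
  obtain ⟨C, hC, h6⟩ := h5 x hx
  exact ⟨C, hC.trans (inter_subset_inter_left _ hUV), h6⟩

theorem eventually_le_pdim_fiber {K : Type u} [MetricSpace K] [CompactSpace K] {n : ℕ}
    (hU : ∀ U : Set K, IsOpen U → (U ∩ fatSet n K).Nonempty →
      dStar pdim n U = dStar pdim n (univ : Set K))
    {s : ℝ≥0} (hs : ((s : ℝ) : EReal) < dStar pdim n (univ : Set K)) :
    ∀ᶠ h : C(K, Fin n → ℝ) in residual C(K, Fin n → ℝ),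
      ∀ y ∈ interior (range h), ((s : ℝ) : EReal) ≤ pdim (h ⁻¹' {y}) := by
  obtain ⟨D, hDc, hD⟩ := exists_countable_dense (Fin n → ℝ)
  obtain ⟨B, hBc, hBo, hB⟩ := exists_countable_nhds_family K
  have key : ∀ᶠ h : C(K, Fin n → ℝ) in residual C(K, Fin n → ℝ), ∀ V ∈ B, ∀ m : ℕ,
      ∀ y ∈ interior (h '' V), HasSeparatedCovers V (1 / ((m : ℝ≥0) + 1)) s h y := by
    refine (eventually_countable_ball hBc).2 fun V hV => eventually_countable_forall.2 fun m => ?_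
    filter_upwards [HasGadget.eventually_residual (V := V) (L := fatSet n K)
      (Q := fun h y => HasSeparatedCovers V (1 / ((m : ℝ≥0) + 1)) s h y) (hBo V hV)
      (fun U hUV hUo hUL => (hasGadget_hasSeparatedCovers hUo (by rwa [hU U hUo hUL])
        (by positivity)).mono subset_rfl fun _ _ H => H.mono hUV) hD
      (eventually_forall_mem_fatSet hDc)] with h hh
    exact hh.1
  filter_upwards [key] with h hh y hy
  exact le_pdim_fiber_of_hasSeparatedCovers hBo hB (fun V hV hyV m => hh V hV m y hyV) hy

/-- Generic fibres over boundary points of the image are finite. -/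
theorem eventually_finite_fiber {K : Type u} [MetricSpace K] [CompactSpace K] {n : ℕ} :
    ∀ᶠ h : C(K, Fin n → ℝ) in residual C(K, Fin n → ℝ),
      ∀ y ∉ interior (range h), (h ⁻¹' {y}).Finite := by
  obtain ⟨D, hDc, hD⟩ := exists_countable_dense (Fin n → ℝ)
  filter_upwards [HasGadget.eventually_residual (V := univ) (L := fatSet n K)
    (Q := fun (h : C(K, Fin n → ℝ)) y => y ∈ interior (range h)) isOpen_univ
    (fun U _ hUo hUL => by
      obtain ⟨C, -, -, H⟩ := exists_hasGadget_mem_interior_image (n := n) hUo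
        (not_indBelow_of_inter_fatSet hUo hUL)
      exact H.mono subset_rfl fun f y hf => interior_mono (image_subset_range _ _) hf) hD
    (eventually_forall_mem_fatSet hDc), eventually_encard_fiber_compl_fatSet_le] with h h1 h2 y hy
  refine ((finite_of_encard_le_coe (h1.2 y hy)).union (finite_of_encard_le_coe (h2 y))).subset ?_
  intro x hx
  by_cases hxL : x ∈ fatSet n K
  · exact Or.inl ⟨hx, mem_univ x, hxL⟩
  · exact Or.inr ⟨hx, hxL⟩

theorem eventually_setOf_dim_fiber_eq_interior_range {K : Type u} [MetricSpace K] [CompactSpace K]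
    {n : ℕ} {dim : Set K → EReal} (hd : IsFiniteStable dim) (hK : 0 < dStar dim n univ)
    (hlow : ∀ s : ℝ≥0, ((s : ℝ) : EReal) < dStar dim n univ →
      ∀ᶠ h : C(K, Fin n → ℝ) in residual C(K, Fin n → ℝ),
        ∀ y ∈ interior (range h), ((s : ℝ) : EReal) ≤ dim (h ⁻¹' {y})) :
    ∀ᶠ f : C(K, Fin n → ℝ) in residual C(K, Fin n → ℝ),
      {y ∈ range ⇑f | dim (⇑f ⁻¹' {y}) = dStar dim n univ} = interior (range ⇑f) := by
  have hlow' : ∀ᶠ h : C(K, Fin n → ℝ) in residual C(K, Fin n → ℝ),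
      ∀ q : ℚ, 0 ≤ q → ((q : ℝ) : EReal) < dStar dim n univ →
        ∀ y ∈ interior (range h), ((q : ℝ) : EReal) ≤ dim (h ⁻¹' {y}) := by
    refine eventually_countable_forall.2 fun q => ?_
    by_cases hq : 0 ≤ q ∧ ((q : ℝ) : EReal) < dStar dim n univ
    · filter_upwards [hlow ⟨q, by exact_mod_cast hq.1⟩ hq.2] with h hh _ _
      exact hh
    · exact Eventually.of_forall fun h h1 h2 => absurd ⟨h1, h2⟩ hq
  filter_upwards [hlow', eventually_finite_fiber,
    eventually_dim_fiber_le hd (A := univ) isOpen_univ] with f h1 h2 h3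
  have hup : ∀ y, dim (f ⁻¹' {y}) ≤ dStar dim n univ := fun y => by
    have := h3 y
    rwa [inter_univ, max_eq_right hK.le] at this
  ext y
  constructor
  · rintro ⟨-, hy⟩
    by_contra hyi
    have := hd.le_zero_of_finite (h2 y hyi)
    rw [hy] at this
    exact not_le.2 hK this
  · intro hy
    refine ⟨interior_subset hy, le_antisymm (hup y) ?_⟩
    by_contra! hlt
    obtain ⟨q, hq1, hq2⟩ := EReal.lt_iff_exists_rat_btwn.1 (max_lt hK hlt)
    have hq0 : (0 : EReal) < ((q : ℝ) : EReal) := (le_max_left _ _).trans_lt hq1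
    have hq0' : 0 ≤ q := by
      have : (0 : ℝ) < q := by exact_mod_cast hq0
      exact_mod_cast this.le
    exact not_le.2 ((le_max_right _ _).trans_lt hq1) (h1 q hq0' hq2 y hy)

/-- An open set of topological dimension at least `n` and small `dStar` produces an open set of
maps which generically have small fibres over an open subset of the image. -/
theorem dStar_eq_or_tdim_lt_of_dense {K : Type u} [MetricSpace K] [CompactSpace K]
    {n : ℕ} (hn : 0 < n) {dim : Set K → EReal} (hd : IsFiniteStable dim)
    (hK : 0 < dStar dim n univ)
    (h : ∀ᶠ f : C(K, Fin n → ℝ) in residual C(K, Fin n → ℝ), interior (range ⇑f) ⊆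
      closure {y ∈ range ⇑f | dim (⇑f ⁻¹' {y}) = dStar dim n univ})
    {U : Set K} (hU : IsOpen U) :
    dStar dim n U = dStar dim n univ ∨ tdim U < (n : EReal) := by
  by_contra! hcon
  obtain ⟨hne, hni⟩ := hcon
  have hlt : dStar dim n U < dStar dim n univ :=
    lt_of_le_of_ne (dStar_mono hd (subset_univ U)) hne
  obtain ⟨C, hCU, hC, f₀, δ, hδ, hf₀⟩ :=
    exists_stable_zero hU fun hi => not_lt.2 hni (tdim_lt_iff.2 hi)
  have : Nonempty (Fin n) := ⟨⟨0, hn⟩⟩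
  obtain ⟨φ, hφ0, hφ1, -⟩ := exists_continuous_zero_one_of_isClosed hU.isClosed_compl hC
    (disjoint_left.2 fun x hx hxC => hx (hCU hxC))
  let f : C(K, Fin n → ℝ) := ⟨fun x => φ x • f₀ x + (1 - φ x) • (1 : Fin n → ℝ), by fun_prop⟩
  have hfC : ∀ x ∈ C, f x = f₀ x := fun x hx => by simp [f, hφ1 hx]
  have hfU : ∀ x ∉ U, f x = 1 := fun x hx => by simp [f, hφ0 hx]
  let ρ : ℝ := min (δ / 2) (1 / 4)
  have hρ : 0 < ρ := lt_min (half_pos hδ) (by norm_num)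
  obtain ⟨g, ⟨hg, hgU⟩, hgρ⟩ :=
    (dense_of_mem_residual (h.and (eventually_dim_fiber_le hd hU))).exists_dist_lt f hρ
  rw [dist_comm] at hgρ
  have hrange : ball 0 ρ ⊆ range g := by
    intro y hy
    rw [mem_ball_zero_iff] at hy
    obtain ⟨x, hx0, hxC⟩ := hf₀ (f₀ + (g - f - ContinuousMap.const K y)) (by
      rw [dist_eq_norm, add_sub_cancel_left]
      refine (norm_sub_le _ _).trans_lt ?_
      rw [dist_eq_norm] at hgρ
      have h1 : ‖ContinuousMap.const K y‖ ≤ ‖y‖ :=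
        (ContinuousMap.norm_le _ (norm_nonneg y)).2 fun _ => le_rfl
      linarith [min_le_left (δ / 2) (1 / 4)])
    refine ⟨x, ?_⟩
    have h2 : f₀ x + (g x - f x - y) = 0 := hx0
    rw [hfC x hxC] at h2
    have h3 : g x - y = 0 := by rw [← h2]; abel
    exact sub_eq_zero.1 h3
  have h0 : (0 : Fin n → ℝ) ∈ interior (range g) :=
    mem_interior.2 ⟨_, hrange, isOpen_ball, mem_ball_self hρ⟩
  obtain ⟨y, ⟨-, hy⟩, hyρ⟩ := Metric.mem_closure_iff.1 (hg h0) ρ hρ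
  rw [dist_zero_left] at hyρ
  have hsub : g ⁻¹' {y} ∩ U = g ⁻¹' {y} := by
    refine inter_eq_left.2 fun x hx => ?_
    by_contra hxU
    have h1 : dist (g x) (f x) < ρ := (ContinuousMap.dist_apply_le_dist x).trans_lt hgρ
    rw [hfU x hxU, mem_singleton_iff.1 hx, dist_comm, dist_eq_norm] at h1
    have h2 := norm_sub_norm_le (1 : Fin n → ℝ) y
    rw [norm_one] at h2
    have h3 : ρ ≤ 1 / 4 := min_le_right _ _
    linarith
  have h4 := hgU y
  rw [hsub, hy] at h4
  exact absurd h4 (not_le.2 (max_lt hK hlt))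

/-- Characterization of spaces where generically all fibers over the interior of the image
have maximal dimension. -/
theorem stmt9 (n : ℕ) (hn : 0 < n) (K : Type*) [MetricSpace K] [CompactSpace K]
    (dimStar : Set K → EReal)
    (hdimStar : dimStar = tdim ∨ dimStar = hdim ∨ dimStar = pdim)
    (hK : 0 < dStar dimStar n (Set.univ : Set K)) :
    ((∀ᶠ (f : C(K, Fin n → ℝ)) in residual C(K, Fin n → ℝ),
        {y ∈ Set.range ⇑f | dimStar (⇑f ⁻¹' {y}) = dStar dimStar n Set.univ}
          = interior (Set.range ⇑f)) ↔
      (∀ U : Set K, IsOpen U →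
        (dStar dimStar n U = dStar dimStar n Set.univ ∨ tdim U < (n : EReal)))) ∧
    ((∀ᶠ (f : C(K, Fin n → ℝ)) in residual C(K, Fin n → ℝ),
        interior (Set.range ⇑f) ⊆
          closure {y ∈ Set.range ⇑f | dimStar (⇑f ⁻¹' {y}) = dStar dimStar n Set.univ}) ↔
      (∀ U : Set K, IsOpen U →
        (dStar dimStar n U = dStar dimStar n Set.univ ∨ tdim U < (n : EReal)))) := by
  have hd : IsFiniteStable dimStar := by
    rcases hdimStar with rfl | rfl | rfl
    exacts [isFiniteStable_tdim, isFiniteStable_hdim, isFiniteStable_pdim]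
  have h31 (h : ∀ U : Set K, IsOpen U →
      (dStar dimStar n U = dStar dimStar n univ ∨ tdim U < (n : EReal))) :
      ∀ᶠ (f : C(K, Fin n → ℝ)) in residual C(K, Fin n → ℝ),
        {y ∈ range ⇑f | dimStar (⇑f ⁻¹' {y}) = dStar dimStar n univ} = interior (range ⇑f) := by
    have hU : ∀ U : Set K, IsOpen U → (U ∩ fatSet n K).Nonempty →
        dStar dimStar n U = dStar dimStar n univ := fun U hUo hUL =>
      (h U hUo).resolve_right fun hlt => not_indBelow_of_inter_fatSet hUo hUL (tdim_lt_iff.1 hlt)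
    refine eventually_setOf_dim_fiber_eq_interior_range hd hK fun s hs => ?_
    rcases hdimStar with rfl | rfl | rfl
    · exact isGδStable_tdim.eventually_le_dim_fiber hd hU hs
    · exact isGδStable_hdim.eventually_le_dim_fiber hd hU hs
    · exact eventually_le_pdim_fiber hU hs
  have h12 (h : ∀ᶠ (f : C(K, Fin n → ℝ)) in residual C(K, Fin n → ℝ),
      {y ∈ range ⇑f | dimStar (⇑f ⁻¹' {y}) = dStar dimStar n univ} = interior (range ⇑f)) :
      ∀ᶠ (f : C(K, Fin n → ℝ)) in residual C(K, Fin n → ℝ), interior (range ⇑f) ⊆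
        closure {y ∈ range ⇑f | dimStar (⇑f ⁻¹' {y}) = dStar dimStar n univ} := by
    filter_upwards [h] with f hf
    rw [hf]
    exact subset_closure
  have h23 := fun h U hUo => dStar_eq_or_tdim_lt_of_dense hn hd hK h (U := U) hUo
  exact ⟨⟨fun h => h23 (h12 h), h31⟩, ⟨h23, fun h => h12 (h31 h)⟩⟩
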